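/- (Theorem 1: convergence of averages.) For each n ∈ {1, …, P} and each real p ≥ 1 there exist finite constants C_{1,n} and C_{2,p} such that, for every initialization x_{1:n}^{(0)} ∈ S_1 × ⋯ × S_n, every measurable f_n: E_n → ℝ with |f_n| ≤ 1 and every integer i ≥ 0, E[| π̂_n^{(i)}(f_n) − π_n(f_n) |^p]^{1/p} ≤ C_{1,n} C_{2,p}/(i+1)^{1/2}. -/

import Mathlib

open MeasureTheory
open scoped ENNReal

namespace Paper

noncomputable section

variable {E : Type*} [MeasurableSpace E]

/-- Metropolis–Hastings acceptance probability. -/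
def acc {Z : Type*} (w : Z → ℝ≥0∞) (x x' : Z) : ℝ≥0∞ := min 1 (w x' / w x)

/-- The importance weight `w_{m+1}` on `E^{m+1}`. -/
def wgt (γ : (n : ℕ) → (Fin n → E) → ℝ≥0∞) (q : (m : ℕ) → (Fin m → E) → E → ℝ≥0∞)
    (m : ℕ) (x : Fin (m + 1) → E) : ℝ≥0∞ :=
  γ (m + 1) x / (γ m (Fin.init x) * q m (Fin.init x) (x (Fin.last m)))

/-- The importance weight `w_1` on `E^1`. -/
def wgt1 (γ : (n : ℕ) → (Fin n → E) → ℝ≥0∞) (q1 : E → ℝ≥0∞) (x : Fin 1 → E) : ℝ≥0∞ :=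
  γ 1 x / q1 (x 0)

/-- The proposal distribution `μ × q_{m+1}`, viewed as a measure on `E^{m+1}`. -/
def propM (dx : Measure E) (q : (m : ℕ) → (Fin m → E) → E → ℝ≥0∞) (m : ℕ)
    (μ : Measure (Fin m → E)) : Measure (Fin (m + 1) → E) :=
  Measure.map (fun p : (Fin m → E) × E => Fin.snoc p.1 p.2)
    ((μ.prod dx).withDensity fun p => q m p.1 p.2)

/-- The proposal distribution at level 1, viewed as a measure on `E^1`. -/
def prop1 (dx : Measure E) (q1 : E → ℝ≥0∞) : Measure (Fin 1 → E) :=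
  Measure.map (fun y : E => fun _ : Fin 1 => y) (dx.withDensity q1)

/-- The Metropolis–Hastings kernel `K_{m+1, μ}`. -/
def kerM (dx : Measure E) (γ : (n : ℕ) → (Fin n → E) → ℝ≥0∞)
    (q : (m : ℕ) → (Fin m → E) → E → ℝ≥0∞) (m : ℕ) (μ : Measure (Fin m → E))
    (x : Fin (m + 1) → E) : Measure (Fin (m + 1) → E) :=
  (propM dx q m μ).withDensity (acc (wgt γ q m) x) +
    (1 - ∫⁻ y, acc (wgt γ q m) x y ∂(propM dx q m μ)) • Measure.dirac x

/-- The Metropolis–Hastings kernel `K_1`. -/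
def ker1 (dx : Measure E) (γ : (n : ℕ) → (Fin n → E) → ℝ≥0∞) (q1 : E → ℝ≥0∞)
    (x : Fin 1 → E) : Measure (Fin 1 → E) :=
  (prop1 dx q1).withDensity (acc (wgt1 γ q1) x) +
    (1 - ∫⁻ y, acc (wgt1 γ q1) x y ∂(prop1 dx q1)) • Measure.dirac x

/-- The target distribution `π_n` on `E^n`. -/
def tgt (dx : Measure E) [SigmaFinite dx] (γ : (n : ℕ) → (Fin n → E) → ℝ≥0∞)
    (Z : ℕ → ℝ≥0∞) (n : ℕ) : Measure (Fin n → E) :=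
  (Measure.pi fun _ : Fin n => dx).withDensity fun x => γ n x / Z n

/-- The marginal density `π_{m+1}(x_m)`. -/
def marg (dx : Measure E) (γ : (n : ℕ) → (Fin n → E) → ℝ≥0∞) (Z : ℕ → ℝ≥0∞) (m : ℕ)
    (x : Fin m → E) : ℝ≥0∞ :=
  (∫⁻ y, γ (m + 1) (Fin.snoc x y) ∂dx) / Z (m + 1)

/-- The ratio `π_{(m+1)/m}(x_m) = π_{m+1}(x_m)/π_m(x_m)`. -/
def ratio (dx : Measure E) (γ : (n : ℕ) → (Fin n → E) → ℝ≥0∞) (Z : ℕ → ℝ≥0∞) (m : ℕ)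
    (x : Fin m → E) : ℝ≥0∞ :=
  marg dx γ Z m x / (γ m x / Z m)

/-- The invariant distribution `ω_{m+1}(μ)`. -/
def omegaM (dx : Measure E) (γ : (n : ℕ) → (Fin n → E) → ℝ≥0∞) (Z : ℕ → ℝ≥0∞) (m : ℕ)
    (μ : Measure (Fin m → E)) : Measure (Fin (m + 1) → E) :=
  (∫⁻ x, ratio dx γ Z m x ∂μ)⁻¹ •
    Measure.map (fun p : (Fin m → E) × E => Fin.snoc p.1 p.2)
      ((μ.prod dx).withDensity fun p =>
        ratio dx γ Z m p.1 *
          ((γ (m + 1) (Fin.snoc p.1 p.2) / Z (m + 1)) / marg dx γ Z m p.1))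

/-- The empirical measure `π̂_n^{(i)}(ω)`. -/
def emp {Ω : Type*} (X : (n : ℕ) → ℕ → Ω → (Fin n → E)) (n i : ℕ) (ω : Ω) :
    Measure (Fin n → E) :=
  ((i : ℝ≥0∞) + 1)⁻¹ • ∑ k ∈ Finset.range (i + 1), Measure.dirac (X n k ω)

/-- The σ-algebra generated by the variables generated strictly before `X_n^{(i)}`
in the order `X_1^{(1)}, …, X_P^{(1)}, X_1^{(2)}, …` (the variables `X_k^{(0)}`
being given at initialization). -/
def past {Ω : Type*} (P : ℕ) (X : (n : ℕ) → ℕ → Ω → (Fin n → E)) (n i : ℕ) :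
    MeasurableSpace Ω :=
  ⨆ (k : ℕ) (j : ℕ) (_ : (1 ≤ k ∧ k ≤ P ∧ j < i) ∨ (1 ≤ k ∧ k < n ∧ j = i)),
    MeasurableSpace.comap (X k j) inferInstance

theorem integrable_of_ae_bound {Ω : Type*} [MeasurableSpace Ω] {μ : Measure Ω}
    [IsFiniteMeasure μ] {f : Ω → ℝ} (hf : Measurable f) {C : ℝ}
    (h : ∀ᵐ ω ∂μ, |f ω| ≤ C) : Integrable f μ :=
  Integrable.of_bound hf.aestronglyMeasurable C (by simpa using h)

theorem exp_mul_le_cosh_add_sinh {c d t : ℝ} (hc : 0 < c) (hd : |d| ≤ c) :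
    Real.exp (t * d) ≤ Real.cosh (t * c) + d * (Real.sinh (t * c) / c) := by
  obtain ⟨h1, h2⟩ := abs_le.1 hd
  have key := convexOn_exp.2 (Set.mem_univ (t * c)) (Set.mem_univ (-(t * c)))
    (show 0 ≤ (1 + d / c) / 2 by
      have : -1 ≤ d / c := by rw [le_div_iff₀ hc]; linarith
      linarith)
    (show 0 ≤ (1 - d / c) / 2 by
      have : d / c ≤ 1 := by rw [div_le_iff₀ hc]; linarith
      linarith) (by ring)
  have e1 : ((1 + d / c) / 2) • (t * c) + ((1 - d / c) / 2) • (-(t * c)) = t * d := by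
    simp only [smul_eq_mul]; field_simp; ring
  rw [e1] at key
  refine key.trans (le_of_eq ?_)
  rw [Real.cosh_eq, Real.sinh_eq]
  simp only [smul_eq_mul]; field_simp; ring

section Martingale

variable {Ω : Type*} [MeasurableSpace Ω] {μ : Measure Ω}

theorem ae_abs_sum_le {D : ℕ → Ω → ℝ} {c : ℝ} (hb : ∀ k, ∀ᵐ ω ∂μ, |D k ω| ≤ c) (N : ℕ) :
    ∀ᵐ ω ∂μ, |∑ j ∈ Finset.range N, D j ω| ≤ N * c := by
  filter_upwards [ae_all_iff.2 hb] with ω hω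
  refine (Finset.abs_sum_le_sum_abs _ _).trans ?_
  refine (Finset.sum_le_sum fun j _ => hω j).trans ?_
  simp

variable [IsProbabilityMeasure μ]

theorem integrable_exp_sum {D : ℕ → Ω → ℝ} (hD : ∀ k, Measurable (D k)) {c : ℝ}
    (hb : ∀ k, ∀ᵐ ω ∂μ, |D k ω| ≤ c) (t : ℝ) (N : ℕ) :
    Integrable (fun ω => Real.exp (t * ∑ j ∈ Finset.range N, D j ω)) μ := by
  refine integrable_of_ae_bound (by fun_prop) (C := Real.exp (|t| * (N * c))) ?_
  filter_upwards [ae_abs_sum_le hb N] with ω hω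
  rw [Real.abs_exp, Real.exp_le_exp]
  refine (le_abs_self _).trans ?_
  rw [abs_mul]
  gcongr

/-- Hoeffding bound for the exponential moments of a sum of bounded martingale differences. -/
theorem integral_exp_sum_le {D : ℕ → Ω → ℝ} (hD : ∀ k, Measurable (D k)) {c : ℝ} (hc : 0 < c)
    (hb : ∀ k, ∀ᵐ ω ∂μ, |D k ω| ≤ c) (t : ℝ)
    (h0 : ∀ k, ∫ ω, Real.exp (t * ∑ j ∈ Finset.range k, D j ω) * D k ω ∂μ = 0) (N : ℕ) :
    ∫ ω, Real.exp (t * ∑ j ∈ Finset.range N, D j ω) ∂μ ≤ Real.exp (N * ((t * c) ^ 2 / 2)) := by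
  induction N with
  | zero => simp
  | succ k ih =>
    have hi := integrable_exp_sum hD hb t k
    have hi2 : Integrable (fun ω => Real.exp (t * ∑ j ∈ Finset.range k, D j ω) * D k ω) μ :=
      hi.mul_bdd (c := c) (hD k).aestronglyMeasurable (by simpa using hb k)
    calc ∫ ω, Real.exp (t * ∑ j ∈ Finset.range (k + 1), D j ω) ∂μ
        ≤ ∫ ω, (Real.cosh (t * c) * Real.exp (t * ∑ j ∈ Finset.range k, D j ω) +
            (Real.sinh (t * c) / c) *
              (Real.exp (t * ∑ j ∈ Finset.range k, D j ω) * D k ω)) ∂μ := by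
          refine integral_mono_ae (integrable_exp_sum hD hb t (k + 1))
            ((hi.const_mul _).add (hi2.const_mul _)) ?_
          filter_upwards [hb k] with ω hω
          rw [Finset.sum_range_succ, mul_add, Real.exp_add]
          have := mul_le_mul_of_nonneg_left (exp_mul_le_cosh_add_sinh (t := t) hc hω)
            (Real.exp_pos (t * ∑ j ∈ Finset.range k, D j ω)).le
          refine this.trans (le_of_eq ?_)
          ring
      _ = Real.cosh (t * c) * ∫ ω, Real.exp (t * ∑ j ∈ Finset.range k, D j ω) ∂μ := by
          rw [integral_add (hi.const_mul _) (hi2.const_mul _), integral_const_mul,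
            integral_const_mul, h0, mul_zero, add_zero]
      _ ≤ Real.exp ((t * c) ^ 2 / 2) * Real.exp (k * ((t * c) ^ 2 / 2)) := by
          gcongr
          exact Real.cosh_le_exp_half_sq _
      _ = _ := by
          rw [← Real.exp_add]; push_cast; ring_nf

theorem rpow_le_rpow_mul_exp {y p : ℝ} (hy : 0 ≤ y) (hp : 0 < p) :
    y ^ p ≤ p ^ p * Real.exp y := by
  have h1 : y / p ≤ Real.exp (y / p) := by linarith [Real.add_one_le_exp (y / p)]
  calc y ^ p = (p * (y / p)) ^ p := by congr 1; field_simp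
    _ = p ^ p * (y / p) ^ p := Real.mul_rpow hp.le (by positivity)
    _ ≤ p ^ p * (Real.exp (y / p)) ^ p := by gcongr
    _ = p ^ p * Real.exp y := by
      rw [← Real.exp_mul]; congr 2; field_simp

/-- Moment bound for a sum of bounded martingale differences. -/
theorem integral_abs_sum_rpow_le {D : ℕ → Ω → ℝ} (hD : ∀ k, Measurable (D k)) {c : ℝ}
    (hc : 0 < c) (hb : ∀ k, ∀ᵐ ω ∂μ, |D k ω| ≤ c)
    (h0 : ∀ t : ℝ, ∀ k, ∫ ω, Real.exp (t * ∑ j ∈ Finset.range k, D j ω) * D k ω ∂μ = 0)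
    {p : ℝ} (hp : 1 ≤ p) (N : ℕ) :
    (∫ ω, |∑ j ∈ Finset.range N, D j ω| ^ p ∂μ) ^ (1 / p) ≤ 4 * p * c * √(N + 1) := by
  have hp0 : 0 < p := by linarith
  set s : ℝ := c * √(N + 1) with hs
  have hs0 : 0 < s := by positivity
  set M : Ω → ℝ := fun ω => ∑ j ∈ Finset.range N, D j ω with hM
  have hexp : ∀ t : ℝ, t ^ 2 = (1 / s) ^ 2 → ∫ ω, Real.exp (t * M ω) ∂μ ≤ 2 := by
    intro t ht
    refine (integral_exp_sum_le hD hc hb t (h0 t) N).trans ?_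
    have e : (N : ℝ) * ((t * c) ^ 2 / 2) ≤ 1 / 2 := by
      rw [mul_pow, ht, hs]
      have : (1 / (c * √((N : ℝ) + 1))) ^ 2 * c ^ 2 = 1 / (N + 1) := by
        rw [div_pow, mul_pow, Real.sq_sqrt (by positivity)]; field_simp
      rw [this, div_div, mul_one_div, div_le_div_iff₀ (by positivity) (by positivity)]
      linarith
    calc Real.exp (N * ((t * c) ^ 2 / 2)) ≤ Real.exp (1 / 2) := Real.exp_le_exp.2 e
      _ ≤ 2 := by
        have h := Real.exp_one_lt_d9
        have h2 : Real.exp (1 / 2) ^ 2 = Real.exp 1 := by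
          rw [← Real.exp_nat_mul]; norm_num
        nlinarith [Real.exp_pos (1 / 2)]
  have hbound : ∫ ω, |M ω| ^ p ∂μ ≤ (4 * p * s) ^ p := by
    have hi1 := integrable_exp_sum hD hb (1 / s) N
    have hi2 := integrable_exp_sum hD hb (-(1 / s)) N
    calc ∫ ω, |M ω| ^ p ∂μ
        ≤ ∫ ω, (s ^ p * p ^ p) * (Real.exp (1 / s * M ω) + Real.exp (-(1 / s) * M ω)) ∂μ := by
          refine integral_mono_of_nonneg (Filter.Eventually.of_forall fun ω => by positivity)
            ((hi1.add hi2).const_mul _) (Filter.Eventually.of_forall fun ω => ?_)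
          have h1 := rpow_le_rpow_mul_exp (y := |M ω| / s) (by positivity) hp0
          have h2 : Real.exp (|M ω| / s) ≤
              Real.exp (1 / s * M ω) + Real.exp (-(1 / s) * M ω) := by
            rcases abs_cases (M ω) with ⟨h, _⟩ | ⟨h, _⟩
            · rw [h, show M ω / s = 1 / s * M ω by ring]
              linarith [Real.exp_pos (-(1 / s) * M ω)]
            · rw [h, show -M ω / s = -(1 / s) * M ω by ring]
              linarith [Real.exp_pos (1 / s * M ω)]
          calc |M ω| ^ p = (s * (|M ω| / s)) ^ p := by congr 1; field_simp
            _ = s ^ p * (|M ω| / s) ^ p := Real.mul_rpow hs0.le (by positivity)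
            _ ≤ s ^ p * (p ^ p * Real.exp (|M ω| / s)) := by gcongr
            _ ≤ s ^ p * (p ^ p * (Real.exp (1 / s * M ω) + Real.exp (-(1 / s) * M ω))) := by
              gcongr
            _ = _ := by ring
      _ = (s ^ p * p ^ p) *
            (∫ ω, Real.exp (1 / s * M ω) ∂μ + ∫ ω, Real.exp (-(1 / s) * M ω) ∂μ) := by
          rw [integral_const_mul, integral_add hi1 hi2]
      _ ≤ (s ^ p * p ^ p) * (2 + 2) := by
          gcongr
          · exact hexp _ rfl
          · exact hexp _ (by ring)
      _ ≤ (s ^ p * p ^ p) * 4 ^ p := by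
          gcongr
          calc (2 : ℝ) + 2 = 4 ^ (1 : ℝ) := by norm_num
            _ ≤ 4 ^ p := Real.rpow_le_rpow_of_exponent_le (by norm_num) hp
      _ = (4 * p * s) ^ p := by
          rw [Real.mul_rpow (by positivity) hs0.le, Real.mul_rpow (by norm_num) hp0.le]; ring
  calc (∫ ω, |M ω| ^ p ∂μ) ^ (1 / p) ≤ ((4 * p * s) ^ p) ^ (1 / p) := by
        refine Real.rpow_le_rpow (integral_nonneg fun ω => by positivity) hbound (by positivity)
    _ = 4 * p * s := by
        rw [← Real.rpow_mul (by positivity), mul_one_div_cancel hp0.ne', Real.rpow_one]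
    _ = _ := by rw [hs]; ring

end Martingale

section Moments

variable {Ω : Type*} [MeasurableSpace Ω] {μ : Measure Ω}

theorem rpow_integral_eq_lpNorm {Y : Ω → ℝ} (hY : Measurable Y) {p : ℝ} (hp : 1 ≤ p) :
    (∫ ω, |Y ω| ^ p ∂μ) ^ (1 / p) = lpNorm Y (ENNReal.ofReal p) μ := by
  have hp0 : 0 < p := by linarith
  rw [lpNorm_eq_integral_norm_rpow_toReal (by simpa using hp0) (by simp) hY.aestronglyMeasurable,
    ENNReal.toReal_ofReal hp0.le, one_div]
  simp only [Real.norm_eq_abs]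

variable [IsProbabilityMeasure μ] in
/-- Minkowski inequality for a pointwise domination by a finite sum. -/
theorem rpow_integral_le_sum {ι : Type*} (s : Finset ι) {Y : Ω → ℝ} (hY : Measurable Y)
    {V : ι → Ω → ℝ} (hV : ∀ k ∈ s, Measurable (V k)) {C : ι → ℝ}
    (hVb : ∀ k ∈ s, ∀ᵐ ω ∂μ, |V k ω| ≤ C k)
    (h : ∀ᵐ ω ∂μ, |Y ω| ≤ ∑ k ∈ s, |V k ω|) {p : ℝ} (hp : 1 ≤ p) :
    (∫ ω, |Y ω| ^ p ∂μ) ^ (1 / p) ≤ ∑ k ∈ s, (∫ ω, |V k ω| ^ p ∂μ) ^ (1 / p) := by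
  have hmem : ∀ k ∈ s, MemLp (fun ω => |V k ω|) (ENNReal.ofReal p) μ := fun k hk =>
    MemLp.of_bound (hV k hk).abs.aestronglyMeasurable (C k) (by simpa using hVb k hk)
  have hle : lpNorm Y (ENNReal.ofReal p) μ ≤
      lpNorm (∑ k ∈ s, fun ω => |V k ω|) (ENNReal.ofReal p) μ := by
    have hm : MemLp (∑ k ∈ s, fun ω => |V k ω|) (ENNReal.ofReal p) μ := memLp_finsetSum' _ hmem
    rw [← toReal_eLpNorm hY.aestronglyMeasurable, ← toReal_eLpNorm hm.aestronglyMeasurable]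
    refine ENNReal.toReal_mono hm.eLpNorm_ne_top (eLpNorm_mono_ae_real ?_)
    filter_upwards [h] with ω hω
    simpa using hω
  rw [rpow_integral_eq_lpNorm hY hp]
  refine hle.trans ((lpNorm_sum_le hmem (by simpa using hp)).trans (le_of_eq ?_))
  refine Finset.sum_congr rfl fun k hk => ?_
  rw [rpow_integral_eq_lpNorm (hV k hk) hp, lpNorm_fun_abs (hV k hk).aestronglyMeasurable]

variable [IsProbabilityMeasure μ] in
theorem rpow_integral_le_add_const {Y U : Ω → ℝ} (hY : Measurable Y) (hU : Measurable U)
    {C c : ℝ} (hUb : ∀ᵐ ω ∂μ, |U ω| ≤ C) (hc : 0 ≤ c)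
    (h : ∀ᵐ ω ∂μ, |Y ω| ≤ |U ω| + c) {p : ℝ} (hp : 1 ≤ p) :
    (∫ ω, |Y ω| ^ p ∂μ) ^ (1 / p) ≤ (∫ ω, |U ω| ^ p ∂μ) ^ (1 / p) + c := by
  have := rpow_integral_le_sum (μ := μ) Finset.univ hY (V := fun b : Bool => cond b U fun _ => c)
    (C := fun b : Bool => cond b C c)
    (by rintro (_ | _) -; exacts [measurable_const, hU])
    (by rintro (_ | _) -
        · simp [abs_of_nonneg hc]
        · exact hUb)
    (by simpa [abs_of_nonneg hc] using h) hp
  refine this.trans (le_of_eq ?_)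
  simp only [Fintype.sum_bool, cond_true, cond_false, abs_of_nonneg hc]
  congr 1
  simp only [integral_const, probReal_univ, one_smul]
  rw [← Real.rpow_mul hc, mul_one_div_cancel (by linarith), Real.rpow_one]

theorem rpow_integral_const_mul {U : Ω → ℝ} {c : ℝ} (hc : 0 ≤ c) {p : ℝ} (hp : 1 ≤ p) :
    (∫ ω, |c * U ω| ^ p ∂μ) ^ (1 / p) = c * (∫ ω, |U ω| ^ p ∂μ) ^ (1 / p) := by
  have hp0 : 0 < p := by linarith
  have : ∀ ω, |c * U ω| ^ p = c ^ p * |U ω| ^ p := fun ω => by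
    rw [abs_mul, abs_of_nonneg hc, Real.mul_rpow hc (abs_nonneg _)]
  simp_rw [this]
  rw [integral_const_mul, Real.mul_rpow (by positivity)
    (integral_nonneg fun ω => by positivity), ← Real.rpow_mul hc, mul_one_div_cancel hp0.ne',
    Real.rpow_one]

end Moments

theorem sum_one_div_sqrt_le (N : ℕ) :
    ∑ k ∈ Finset.range N, 1 / √((k : ℝ) + 1) ≤ 2 * √N := by
  induction N with
  | zero => simp
  | succ k ih =>
    rw [Finset.sum_range_succ]
    push_cast
    have h1 : 0 < √((k : ℝ) + 1) := by positivity
    have h2 := Real.sq_sqrt (show (0 : ℝ) ≤ (k : ℝ) + 1 by positivity)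
    have h3 := Real.sq_sqrt (show (0 : ℝ) ≤ (k : ℝ) by positivity)
    have h4 : 1 / √((k : ℝ) + 1) ≤ 2 * √((k : ℝ) + 1) - 2 * √k := by
      rw [div_le_iff₀ h1]
      nlinarith [sq_nonneg (√((k : ℝ) + 1) - √k)]
    linarith

theorem sum_one_div_succ_le (N : ℕ) :
    ∑ k ∈ Finset.range N, 1 / ((k : ℝ) + 1) ≤ 2 * √N := by
  refine le_trans (Finset.sum_le_sum fun k _ => ?_) (sum_one_div_sqrt_le N)
  have : √((k : ℝ) + 1) ≤ (k : ℝ) + 1 :=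
    Real.sqrt_le_iff.2 ⟨by positivity, by nlinarith [(k.cast_nonneg : (0 : ℝ) ≤ k)]⟩
  exact one_div_le_one_div_of_le (by positivity) this

section JointLaw

open ProbabilityTheory

variable {Ω Z 𝒴 : Type*} {F mΩ : MeasurableSpace Ω} [MeasurableSpace Z] [MeasurableSpace 𝒴]
  {μ : Measure Ω} [IsProbabilityMeasure μ]

/-- If `κ (Y ·)` is a version of the conditional law of `X` given `F` and `Y` is `F`-measurable,
then the joint law of `(Y, X)` is the composition-product of the law of `Y` with `κ`. -/
theorem map_prodMk_eq_compProd (hF : F ≤ mΩ) {X : Ω → Z}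
    (hX : Measurable X) {Y : Ω → 𝒴} (hY : Measurable[F] Y) (κ : Kernel 𝒴 Z) [IsMarkovKernel κ]
    (hκ : ∀ B, MeasurableSet B →
      μ[fun ω => B.indicator (fun _ => (1 : ℝ)) (X ω)|F] =ᵐ[μ] fun ω => (κ (Y ω)).real B) :
    μ.map (fun ω => (Y ω, X ω)) = (μ.map Y) ⊗ₘ κ := by
  have hY' : Measurable Y := hY.mono hF le_rfl
  have hYX : Measurable fun ω => (Y ω, X ω) := hY'.prodMk hX
  have : IsProbabilityMeasure (μ.map Y) := Measure.isProbabilityMeasure_map hY'.aemeasurable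
  have : IsProbabilityMeasure (μ.map fun ω => (Y ω, X ω)) :=
    Measure.isProbabilityMeasure_map hYX.aemeasurable
  refine Measure.ext_prod fun {s t} hs ht => ?_
  rw [Measure.map_apply hYX (hs.prod ht), Measure.compProd_apply_prod hs ht,
    setLIntegral_map hs (κ.measurable_coe ht) hY']
  have hmt : Measurable fun ω => κ (Y ω) t := (κ.measurable_coe ht).comp hY'
  have h1 : ∫ ω in Y ⁻¹' s, t.indicator (fun _ => (1 : ℝ)) (X ω) ∂μ =
      ∫ ω in Y ⁻¹' s, (κ (Y ω)).real t ∂μ := by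
    rw [← setIntegral_condExp hF _ (hY hs)]
    · exact integral_congr_ae (ae_restrict_of_ae (hκ t ht))
    · refine Integrable.of_bound (C := 1)
        ((measurable_const.indicator ht).comp hX).aestronglyMeasurable ?_
      exact Filter.Eventually.of_forall fun ω => by
        by_cases h : X ω ∈ t <;> simp [h]
  have h2 : ∫ ω in Y ⁻¹' s, t.indicator (fun _ => (1 : ℝ)) (X ω) ∂μ =
      μ.real ((fun ω => (Y ω, X ω)) ⁻¹' s ×ˢ t) := by
    have e : (fun ω => t.indicator (fun _ => (1 : ℝ)) (X ω)) =
        (X ⁻¹' t).indicator fun _ => (1 : ℝ) := rfl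
    rw [e, integral_indicator (hX ht), Measure.restrict_restrict (hX ht)]
    simp only [integral_const, measureReal_restrict_apply_univ, smul_eq_mul, mul_one]
    congr 1
    ext ω; simp [and_comm]
  have h3 : ∫ ω in Y ⁻¹' s, (κ (Y ω)).real t ∂μ = (∫⁻ ω in Y ⁻¹' s, κ (Y ω) t ∂μ).toReal := by
    simp only [Measure.real]
    exact integral_toReal hmt.aemeasurable (Filter.Eventually.of_forall fun ω => by simp)
  rw [h2, h3, Measure.real] at h1
  refine (ENNReal.toReal_eq_toReal_iff' (by simp) ?_).1 h1
  refine ne_top_of_le_ne_top ENNReal.one_ne_top ?_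
  calc ∫⁻ ω in Y ⁻¹' s, κ (Y ω) t ∂μ ≤ ∫⁻ ω in Y ⁻¹' s, 1 ∂μ :=
        lintegral_mono fun ω => prob_le_one
    _ ≤ 1 := by simpa using prob_le_one

/-- Integrating a function of `(Y, X)` whose conditional mean vanishes gives zero. -/
theorem integral_comp_eq_zero (hF : F ≤ mΩ) {X : Ω → Z}
    (hX : Measurable X) {Y : Ω → 𝒴} (hY : Measurable[F] Y) (κ : Kernel 𝒴 Z) [IsMarkovKernel κ]
    (hκ : ∀ B, MeasurableSet B →
      μ[fun ω => B.indicator (fun _ => (1 : ℝ)) (X ω)|F] =ᵐ[μ] fun ω => (κ (Y ω)).real B)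
    {G : 𝒴 × Z → ℝ} (hG : Measurable G) (hGi : Integrable (fun ω => G (Y ω, X ω)) μ)
    (h0 : ∀ y, ∫ z, G (y, z) ∂(κ y) = 0) :
    ∫ ω, G (Y ω, X ω) ∂μ = 0 := by
  have hY' : Measurable Y := hY.mono hF le_rfl
  have hYX : Measurable fun ω => (Y ω, X ω) := hY'.prodMk hX
  have : IsProbabilityMeasure (μ.map Y) := Measure.isProbabilityMeasure_map hY'.aemeasurable
  have e : ∫ ω, G (Y ω, X ω) ∂μ = ∫ yz, G yz ∂(μ.map fun ω => (Y ω, X ω)) :=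
    (integral_map hYX.aemeasurable hG.aestronglyMeasurable).symm
  have hi : Integrable G (μ.map fun ω => (Y ω, X ω)) :=
    (integrable_map_measure hG.aestronglyMeasurable hYX.aemeasurable).2 hGi
  rw [e]
  rw [map_prodMk_eq_compProd hF hX hY κ hκ] at hi ⊢
  rw [Measure.integral_compProd hi]
  simp [h0]

end JointLaw

section MetropolisHastings

variable {Z : Type*} [MeasurableSpace Z]

/-- The independent Metropolis–Hastings kernel with weight `w` and proposal `ν`. -/
def mh (w : Z → ℝ≥0∞) (ν : Measure Z) (x : Z) : Measure Z :=
  ν.withDensity (acc w x) + (1 - ∫⁻ y, acc w x y ∂ν) • Measure.dirac x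

/-- The normalised real-valued weight. -/
def nwt (w : Z → ℝ≥0∞) (b : ℝ) (z : Z) : ℝ := (w z).toReal / b

/-- Truncated Neumann series solving the Poisson equation of `mh w ν` up to a geometric error. -/
def poisson (w : Z → ℝ≥0∞) (b : ℝ) (f : Z → ℝ) : ℕ → Measure Z → Z → ℝ
  | 0 => fun _ _ => 0
  | J + 1 => fun ν x =>
      f x + (∫ y, poisson w b f J ν y ∂(mh w ν x) - ∫ y, nwt w b y * poisson w b f J ν y ∂ν)

variable {w : Z → ℝ≥0∞}

omit [MeasurableSpace Z] in
theorem acc_le_one (x y : Z) : acc w x y ≤ 1 := min_le_left _ _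

omit [MeasurableSpace Z] in
theorem acc_ne_top (x y : Z) : acc w x y ≠ ⊤ :=
  ne_top_of_le_ne_top ENNReal.one_ne_top (acc_le_one x y)

omit [MeasurableSpace Z] in
theorem toReal_acc_le_one (x y : Z) : (acc w x y).toReal ≤ 1 := by
  simpa using ENNReal.toReal_mono ENNReal.one_ne_top (acc_le_one (w := w) x y)

theorem measurable_acc (hw : Measurable w) : Measurable fun p : Z × Z => acc w p.1 p.2 := by
  unfold acc; fun_prop

theorem measurable_acc_right (hw : Measurable w) (x : Z) : Measurable (acc w x) :=
  (measurable_acc hw).comp measurable_prodMk_left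

theorem lintegral_acc_le_one (x : Z) (ν : Measure Z) [IsProbabilityMeasure ν] :
    ∫⁻ y, acc w x y ∂ν ≤ 1 := by
  calc ∫⁻ y, acc w x y ∂ν ≤ ∫⁻ _, 1 ∂ν := lintegral_mono fun y => acc_le_one x y
    _ = 1 := by simp

instance isProbabilityMeasure_mh (ν : Measure Z) [IsProbabilityMeasure ν] (x : Z) :
    IsProbabilityMeasure (mh w ν x) := by
  constructor
  simp only [mh, Measure.coe_add, Pi.add_apply, Measure.smul_apply, measure_univ, smul_eq_mul,
    mul_one, withDensity_apply _ MeasurableSet.univ, Measure.restrict_univ]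
  exact add_tsub_cancel_of_le (lintegral_acc_le_one x ν)

theorem integrable_of_abs_le {ν : Measure Z} [IsFiniteMeasure ν] {g : Z → ℝ} (hg : Measurable g)
    {M : ℝ} (hM : ∀ z, |g z| ≤ M) : Integrable g ν :=
  integrable_of_ae_bound hg (Filter.Eventually.of_forall hM)

theorem abs_integral_le_of_abs_le {ν : Measure Z} [IsProbabilityMeasure ν] {g : Z → ℝ}
    {M : ℝ} (hM : ∀ z, |g z| ≤ M) : |∫ z, g z ∂ν| ≤ M := by
  have := norm_integral_le_of_norm_le_const (μ := ν) (f := g) (C := M)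
    (Filter.Eventually.of_forall hM)
  simpa using this

theorem integral_mh (hw : Measurable w) (ν : Measure Z) [IsProbabilityMeasure ν] (x : Z)
    {g : Z → ℝ} (hg : Measurable g) {M : ℝ} (hM : ∀ z, |g z| ≤ M) :
    ∫ z, g z ∂(mh w ν x) = ∫ y, (acc w x y).toReal * (g y - g x) ∂ν + g x := by
  have ha := measurable_acc_right hw x
  have hle := lintegral_acc_le_one (w := w) x ν
  have : IsFiniteMeasure (ν.withDensity (acc w x)) :=
    isFiniteMeasure_withDensity (ne_top_of_le_ne_top ENNReal.one_ne_top hle)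
  have hint : Integrable (fun y => (acc w x y).toReal) ν := by
    refine integrable_of_abs_le ha.ennreal_toReal (M := 1) fun y => ?_
    rw [abs_of_nonneg ENNReal.toReal_nonneg]; exact toReal_acc_le_one x y
  have hfin : 1 - ∫⁻ y, acc w x y ∂ν ≠ ⊤ :=
    ne_top_of_le_ne_top ENNReal.one_ne_top tsub_le_self
  rw [mh, integral_add_measure (integrable_of_abs_le hg hM)
    ((integrable_of_abs_le hg hM).smul_measure hfin), integral_smul_measure,
    integral_dirac' _ _ hg.stronglyMeasurable,
    integral_withDensity_eq_integral_toReal_smul ha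
      (Filter.Eventually.of_forall fun y => (acc_ne_top x y).lt_top),
    ENNReal.toReal_sub_of_le hle ENNReal.one_ne_top]
  have e : (∫⁻ y, acc w x y ∂ν).toReal = ∫ y, (acc w x y).toReal ∂ν :=
    (integral_toReal ha.aemeasurable
      (Filter.Eventually.of_forall fun y => (acc_ne_top x y).lt_top)).symm
  have hi2 : Integrable (fun y => (acc w x y).toReal * g y) ν :=
    hint.mul_bdd (c := M) hg.aestronglyMeasurable (Filter.Eventually.of_forall hM)
  simp_rw [mul_sub]
  rw [e, integral_sub hi2 (hint.mul_const _), integral_mul_const]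
  simp only [smul_eq_mul, ENNReal.toReal_one]
  ring

section Weight

variable {b : ℝ} (hw : Measurable w) (hb : 0 < b) (hwb : ∀ z, w z ≤ ENNReal.ofReal b)

omit [MeasurableSpace Z] in
include hb in
theorem nwt_nonneg (z : Z) : 0 ≤ nwt w b z := by unfold nwt; positivity

include hw in
theorem measurable_nwt : Measurable (nwt w b) := by unfold nwt; fun_prop

include hb hwb

omit [MeasurableSpace Z] in
theorem nwt_le_one (z : Z) : nwt w b z ≤ 1 := by
  unfold nwt
  rw [div_le_one hb]
  exact ENNReal.toReal_le_of_le_ofReal hb.le (hwb z)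

omit [MeasurableSpace Z] in
theorem abs_nwt_le_one (z : Z) : |nwt w b z| ≤ 1 := by
  rw [abs_of_nonneg (nwt_nonneg hb z)]; exact nwt_le_one hb hwb z

omit [MeasurableSpace Z] in
theorem nwt_le_acc (x y : Z) : nwt w b y ≤ (acc w x y).toReal := by
  have hb' : ENNReal.ofReal b ≠ 0 := by simpa using hb
  have h : w y / ENNReal.ofReal b ≤ acc w x y := by
    refine le_min ?_ (ENNReal.div_le_div_left (hwb x) _)
    exact ENNReal.div_le_of_le_mul (by simpa using hwb y)
  have := ENNReal.toReal_mono (acc_ne_top x y) h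
  rwa [ENNReal.toReal_div, ENNReal.toReal_ofReal hb.le] at this

omit [MeasurableSpace Z] in
theorem nwt_mul_acc (x y : Z) :
    nwt w b x * (acc w x y).toReal = min (nwt w b x) (nwt w b y) := by
  have hx : w x ≠ ⊤ := ne_top_of_le_ne_top ENNReal.ofReal_ne_top (hwb x)
  have hy : w y ≠ ⊤ := ne_top_of_le_ne_top ENNReal.ofReal_ne_top (hwb y)
  by_cases h0 : w x = 0
  · have : nwt w b x = 0 := by simp [nwt, h0]
    rw [this, zero_mul, min_eq_left (nwt_nonneg hb y)]
  · have h1 : 0 < (w x).toReal := ENNReal.toReal_pos h0 hx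
    have h2 : (acc w x y).toReal = min 1 ((w y).toReal / (w x).toReal) := by
      unfold acc
      rw [ENNReal.toReal_min ENNReal.one_ne_top (ENNReal.div_ne_top hy h0), ENNReal.toReal_div,
        ENNReal.toReal_one]
    have h3 : 0 < nwt w b x := by unfold nwt; positivity
    rw [h2, mul_min_of_nonneg _ _ h3.le, mul_one]
    congr 1
    unfold nwt
    field_simp

variable {ν : Measure Z} [IsProbabilityMeasure ν]

include hw

theorem integrable_nwt : Integrable (nwt w b) ν :=
  integrable_of_abs_le (measurable_nwt hw) (abs_nwt_le_one hb hwb)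

theorem integrable_nwt_mul {g : Z → ℝ} (hg : Measurable g) {M : ℝ} (hM : ∀ z, |g z| ≤ M) :
    Integrable (fun y => nwt w b y * g y) ν :=
  (integrable_nwt hw hb hwb).mul_bdd (c := M) hg.aestronglyMeasurable
    (Filter.Eventually.of_forall hM)

/-- The residual kernel `mh w ν x - nwt · ν` integrates `g` against a fixed integrand. -/
theorem residual_eq (x : Z) {g : Z → ℝ} (hg : Measurable g) {M : ℝ} (hM : ∀ z, |g z| ≤ M) :
    ∫ y, g y ∂(mh w ν x) - ∫ y, nwt w b y * g y ∂ν =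
      ∫ y, ((acc w x y).toReal * (g y - g x) - nwt w b y * g y) ∂ν + g x := by
  have ha := measurable_acc_right hw x
  rw [integral_mh hw ν x hg hM, integral_sub _ (integrable_nwt_mul hw hb hwb hg hM)]
  · ring
  · refine integrable_of_abs_le (by fun_prop) (M := 1 * (M + M)) fun y => ?_
    rw [abs_mul, abs_of_nonneg ENNReal.toReal_nonneg]
    have := (abs_sub _ _).trans (add_le_add (hM y) (hM x))
    exact mul_le_mul (toReal_acc_le_one x y) this (abs_nonneg _) zero_le_one

omit hw [IsProbabilityMeasure ν] [MeasurableSpace Z] in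
theorem abs_residual_integrand_le (x : Z) {g : Z → ℝ} {M : ℝ} (hM : ∀ z, |g z| ≤ M) (y : Z) :
    |(acc w x y).toReal * (g y - g x) - nwt w b y * g y| ≤ 2 * M := by
  have h0 := nwt_nonneg (w := w) hb y
  have h1 := nwt_le_acc hb hwb x y
  have h2 := toReal_acc_le_one (w := w) x y
  have hy := abs_le.1 (hM y)
  have hx := abs_le.1 (hM x)
  rw [abs_le]
  constructor <;> nlinarith

theorem abs_residual_le (x : Z) {g : Z → ℝ} (hg : Measurable g) {M : ℝ} (hM : ∀ z, |g z| ≤ M) :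
    |∫ y, g y ∂(mh w ν x) - ∫ y, nwt w b y * g y ∂ν| ≤ (1 - ∫ y, nwt w b y ∂ν) * M := by
  have ha := (measurable_acc_right hw x).ennreal_toReal
  have hu := measurable_nwt (b := b) hw
  rw [residual_eq hw hb hwb x hg hM]
  have hi := integrable_of_abs_le (ν := ν)
    (by fun_prop : Measurable fun y => (acc w x y).toReal * (g y - g x) - nwt w b y * g y)
    (abs_residual_integrand_le hb hwb x hM)
  have e : ∫ y, ((acc w x y).toReal * (g y - g x) - nwt w b y * g y) ∂ν + g x =
      ∫ y, ((acc w x y).toReal * (g y - g x) - nwt w b y * g y + g x) ∂ν := by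
    rw [integral_add hi (integrable_const _)]; simp
  have e2 : (1 - ∫ y, nwt w b y ∂ν) * M = ∫ y, (1 - nwt w b y) * M ∂ν := by
    rw [integral_mul_const, integral_sub (integrable_const _) (integrable_nwt hw hb hwb)]; simp
  rw [e, e2]
  refine (abs_integral_le_integral_abs).trans (integral_mono
    (hi.add (integrable_const _)).abs
    (((integrable_const _).sub (integrable_nwt hw hb hwb)).mul_const _) fun y => ?_)
  have h0 := nwt_nonneg (w := w) hb y
  have h1 := nwt_le_acc hb hwb x y
  have h2 := toReal_acc_le_one (w := w) x y
  have hy := abs_le.1 (hM y)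
  have hx := abs_le.1 (hM x)
  show |_| ≤ _
  rw [abs_le]
  constructor <;> nlinarith

omit hb hwb hw [IsProbabilityMeasure ν] in
theorem abs_integral_sub_le_of_close {ν' : Measure Z} {η : ℝ}
    (hη : ∀ g : Z → ℝ, Measurable g → (∀ z, |g z| ≤ 1) → |∫ z, g z ∂ν - ∫ z, g z ∂ν'| ≤ η)
    {g : Z → ℝ} (hg : Measurable g) {M : ℝ} (hM0 : 0 < M) (hM : ∀ z, |g z| ≤ M) :
    |∫ z, g z ∂ν - ∫ z, g z ∂ν'| ≤ M * η := by
  have := hη (fun z => g z / M) (by fun_prop) fun z => by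
    rw [abs_div, abs_of_pos hM0, div_le_one hM0]; exact hM z
  rw [integral_div, integral_div, ← sub_div, abs_div, abs_of_pos hM0, div_le_iff₀ hM0] at this
  linarith

omit hb hwb in
theorem abs_integral_mh_sub_le {ν' : Measure Z} [IsProbabilityMeasure ν'] {η : ℝ}
    (hη : ∀ g : Z → ℝ, Measurable g → (∀ z, |g z| ≤ 1) → |∫ z, g z ∂ν - ∫ z, g z ∂ν'| ≤ η)
    (x : Z) {g : Z → ℝ} (hg : Measurable g) {M : ℝ} (hM0 : 0 < M) (hM : ∀ z, |g z| ≤ M) :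
    |∫ y, g y ∂(mh w ν x) - ∫ y, g y ∂(mh w ν' x)| ≤ 2 * M * η := by
  have ha := (measurable_acc_right hw x).ennreal_toReal
  rw [integral_mh hw ν x hg hM, integral_mh hw ν' x hg hM, add_sub_add_right_eq_sub]
  refine abs_integral_sub_le_of_close hη (by fun_prop) (by positivity) fun y => ?_
  have h1 : 0 ≤ (acc w x y).toReal := ENNReal.toReal_nonneg
  have h2 := toReal_acc_le_one (w := w) x y
  have hy := abs_le.1 (hM y)
  have hx := abs_le.1 (hM x)
  rw [abs_le]
  constructor <;> nlinarith

theorem abs_residual_sub_le {ν' : Measure Z} [IsProbabilityMeasure ν'] {η : ℝ}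
    (hη : ∀ g : Z → ℝ, Measurable g → (∀ z, |g z| ≤ 1) → |∫ z, g z ∂ν - ∫ z, g z ∂ν'| ≤ η)
    (x : Z) {g : Z → ℝ} (hg : Measurable g) {M : ℝ} (hM0 : 0 < M) (hM : ∀ z, |g z| ≤ M) :
    |(∫ y, g y ∂(mh w ν x) - ∫ y, nwt w b y * g y ∂ν) -
      (∫ y, g y ∂(mh w ν' x) - ∫ y, nwt w b y * g y ∂ν')| ≤ 2 * M * η := by
  have ha := (measurable_acc_right hw x).ennreal_toReal
  have hu := measurable_nwt (b := b) hw
  rw [residual_eq hw hb hwb x hg hM, residual_eq hw hb hwb x hg hM, add_sub_add_right_eq_sub]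
  exact abs_integral_sub_le_of_close hη (by fun_prop) (by positivity)
    (abs_residual_integrand_le hb hwb x hM)

/-- Reversibility: the measure with density `nwt w b` with respect to `ν` is invariant. -/
theorem integral_nwt_mul_sub_mh {g : Z → ℝ} (hg : Measurable g) {M : ℝ} (hM : ∀ z, |g z| ≤ M) :
    ∫ x, nwt w b x * (g x - ∫ y, g y ∂(mh w ν x)) ∂ν = 0 := by
  have hu := measurable_nwt (b := b) hw
  have e : ∀ x, nwt w b x * (g x - ∫ y, g y ∂(mh w ν x)) =
      ∫ y, min (nwt w b x) (nwt w b y) * (g x - g y) ∂ν := fun x => by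
    rw [integral_mh hw ν x hg hM, sub_add_cancel_right, mul_neg, ← integral_const_mul,
      ← integral_neg]
    refine integral_congr_ae (Filter.Eventually.of_forall fun y => ?_)
    simp only
    rw [← nwt_mul_acc hb hwb x y]; ring
  simp_rw [e]
  have hint : Integrable (Function.uncurry fun x y =>
      min (nwt w b x) (nwt w b y) * (g x - g y)) (ν.prod ν) := by
    refine integrable_of_ae_bound (C := 1 * (M + M)) (by unfold Function.uncurry; fun_prop)
      (Filter.Eventually.of_forall fun p => ?_)
    simp only [Function.uncurry]
    rw [abs_mul, abs_of_nonneg (le_min (nwt_nonneg hb _) (nwt_nonneg hb _))]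
    exact mul_le_mul ((min_le_left _ _).trans (nwt_le_one hb hwb _))
      ((abs_sub _ _).trans (add_le_add (hM _) (hM _))) (abs_nonneg _) zero_le_one
  have hs := integral_integral_swap hint
  have hn : ∫ y, ∫ x, min (nwt w b x) (nwt w b y) * (g x - g y) ∂ν ∂ν =
      -∫ x, ∫ y, min (nwt w b x) (nwt w b y) * (g x - g y) ∂ν ∂ν := by
    rw [← integral_neg]
    refine integral_congr_ae (Filter.Eventually.of_forall fun x => ?_)
    simp only
    rw [← integral_neg]
    refine integral_congr_ae (Filter.Eventually.of_forall fun y => ?_)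
    simp only
    rw [min_comm]; ring
  linarith

end Weight

end MetropolisHastings

section PoissonEquation

open ProbabilityTheory

variable {Z : Type*} [MeasurableSpace Z]

/-- Probability measures with the σ-algebra of evaluations. -/
abbrev ProbMeas (Z : Type*) [MeasurableSpace Z] : Type _ :=
  {ν : Measure Z // IsProbabilityMeasure ν}

/-- The tautological Markov kernel on probability measures. -/
def evalKernel (Z : Type*) [MeasurableSpace Z] : Kernel (ProbMeas Z) Z :=
  ⟨Subtype.val, measurable_subtype_coe⟩

instance : IsMarkovKernel (evalKernel Z) := ⟨fun ν => ν.2⟩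

theorem measurable_mh {w : Z → ℝ≥0∞} (hw : Measurable w) :
    Measurable fun p : ProbMeas Z × Z => mh w p.1.1 p.2 := by
  have key : ∀ s : Set Z, MeasurableSet s → Measurable fun p : ProbMeas Z × Z =>
      ∫⁻ y, s.indicator (acc w p.2) y ∂(p.1 : Measure Z) := fun s hs => by
    have h : Measurable (Function.uncurry fun (p : ProbMeas Z × Z) (y : Z) =>
        s.indicator (acc w p.2) y) := by
      have : (Function.uncurry fun (p : ProbMeas Z × Z) (y : Z) => s.indicator (acc w p.2) y) =
          (Prod.snd ⁻¹' s).indicator fun q : (ProbMeas Z × Z) × Z => acc w q.1.2 q.2 := by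
        ext q; rfl
      rw [this]
      refine Measurable.indicator ?_ (measurable_snd hs)
      exact (measurable_acc hw).comp
        ((measurable_snd.comp measurable_fst).prodMk measurable_snd)
    exact Measurable.lintegral_kernel_prod_right
      (κ := (evalKernel Z).comap Prod.fst (measurable_fst (β := Z))) h
  refine Measure.measurable_of_measurable_coe _ fun s hs => ?_
  have e : ∀ p : ProbMeas Z × Z, mh w p.1.1 p.2 s =
      ∫⁻ y, s.indicator (acc w p.2) y ∂(p.1 : Measure Z) +
      (1 - ∫⁻ y, Set.univ.indicator (acc w p.2) y ∂(p.1 : Measure Z)) * s.indicator 1 p.2 :=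
    fun p => by
      simp only [mh, Measure.coe_add, Pi.add_apply, Measure.smul_apply, smul_eq_mul,
        withDensity_apply _ hs, Measure.dirac_apply' _ hs, lintegral_indicator hs,
        Set.indicator_univ]
  simp_rw [e]
  exact (key s hs).add ((measurable_const.sub (key _ MeasurableSet.univ)).mul
    ((measurable_one.indicator hs).comp measurable_snd))

/-- The Metropolis–Hastings kernel as a kernel in the proposal and the current state. -/
def mhKernel {w : Z → ℝ≥0∞} (hw : Measurable w) : Kernel (ProbMeas Z × Z) Z :=
  ⟨fun p => mh w p.1.1 p.2, measurable_mh hw⟩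

instance {w : Z → ℝ≥0∞} (hw : Measurable w) : IsMarkovKernel (mhKernel hw) :=
  ⟨fun p => by have := p.1.2; exact isProbabilityMeasure_mh p.1.1 p.2⟩

variable {w : Z → ℝ≥0∞} {b : ℝ} (hw : Measurable w) (hb : 0 < b)
  (hwb : ∀ z, w z ≤ ENNReal.ofReal b) {f : Z → ℝ} (hf : Measurable f) (hf1 : ∀ z, |f z| ≤ 1)

include hw in
theorem measurable_integral_mh {h : Measure Z → Z → ℝ}
    (hh : Measurable fun p : ProbMeas Z × Z => h p.1.1 p.2) :
    Measurable fun p : ProbMeas Z × Z => ∫ y, h p.1.1 y ∂(mh w p.1.1 p.2) := by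
  have : StronglyMeasurable (Function.uncurry fun (p : ProbMeas Z × Z) (y : Z) => h p.1.1 y) :=
    (hh.comp ((measurable_fst.comp measurable_fst).prodMk measurable_snd)).stronglyMeasurable
  exact (this.integral_kernel_prod_right (κ := mhKernel hw)).measurable

include hw hf

theorem measurable_poisson (J : ℕ) :
    Measurable fun p : ProbMeas Z × Z => poisson w b f J p.1.1 p.2 := by
  induction J with
  | zero => exact measurable_const
  | succ J ih =>
    have hu : Measurable (nwt w b) := measurable_nwt hw
    have h2 : StronglyMeasurable (Function.uncurry fun (ν : ProbMeas Z) (y : Z) =>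
        nwt w b y * poisson w b f J ν.1 y) :=
      ((hu.comp measurable_snd).mul ih).stronglyMeasurable
    exact (hf.comp measurable_snd).add ((measurable_integral_mh hw ih).sub
      ((h2.integral_kernel_prod_right (κ := evalKernel Z)).measurable.comp measurable_fst))

theorem measurable_poisson_right (J : ℕ) (ν : Measure Z) [hν : IsProbabilityMeasure ν] :
    Measurable (poisson w b f J ν) :=
  (measurable_poisson hw hf J).comp (measurable_prodMk_left (x := (⟨ν, hν⟩ : ProbMeas Z)))

include hb hwb hf1

theorem abs_poisson_le (J : ℕ) (ν : Measure Z) [IsProbabilityMeasure ν] (x : Z) :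
    |poisson w b f J ν x| ≤ J := by
  induction J generalizing x with
  | zero => simp [poisson]
  | succ J ih =>
    have h1 := abs_residual_le hw hb hwb (ν := ν) x (measurable_poisson_right hw hf J ν) ih
    have h2 : 0 ≤ ∫ y, nwt w b y ∂ν := integral_nonneg fun y => nwt_nonneg hb y
    have h3 : (1 - ∫ y, nwt w b y ∂ν) * J ≤ J := by
      nlinarith [(J.cast_nonneg : (0 : ℝ) ≤ J)]
    simp only [poisson]
    refine (abs_add_le _ _).trans ?_
    push_cast
    linarith [hf1 x]

variable {ε : ℝ} (hε : 0 < ε) {ν : Measure Z} [IsProbabilityMeasure ν]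
  (hν : ε ≤ ∫ y, nwt w b y ∂ν)

include hε hν

theorem abs_poisson_le_inv (J : ℕ) (x : Z) : |poisson w b f J ν x| ≤ 1 / ε := by
  induction J generalizing x with
  | zero => simp [poisson, hε.le]
  | succ J ih =>
    have h1 := abs_residual_le hw hb hwb (ν := ν) x (measurable_poisson_right hw hf J ν) ih
    have h3 : (1 - ∫ y, nwt w b y ∂ν) * (1 / ε) ≤ (1 - ε) * (1 / ε) := by gcongr
    have h4 : (1 - ε) * (1 / ε) = 1 / ε - 1 := by field_simp
    simp only [poisson]
    refine (abs_add_le _ _).trans ?_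
    linarith [hf1 x]

omit hε in
theorem abs_poisson_succ_sub_le (J : ℕ) (x : Z) :
    |poisson w b f (J + 1) ν x - poisson w b f J ν x| ≤ (1 - ε) ^ J := by
  induction J generalizing x with
  | zero => simpa [poisson] using hf1 x
  | succ J ih =>
    have m1 := measurable_poisson_right (b := b) hw hf (J + 1) ν
    have m2 := measurable_poisson_right (b := b) hw hf J ν
    have b1 := abs_poisson_le hw hb hwb hf hf1 (J + 1) ν
    have b2 := abs_poisson_le hw hb hwb hf hf1 J ν
    have h1 := abs_residual_le hw hb hwb (ν := ν) x (m1.sub m2) ih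
    have e : poisson w b f (J + 1 + 1) ν x - poisson w b f (J + 1) ν x =
        ∫ y, (poisson w b f (J + 1) ν - poisson w b f J ν) y ∂(mh w ν x) -
          ∫ y, nwt w b y * (poisson w b f (J + 1) ν - poisson w b f J ν) y ∂ν := by
      simp only [Pi.sub_apply, mul_sub]
      rw [integral_sub (integrable_of_abs_le m1 b1) (integrable_of_abs_le m2 b2),
        integral_sub (integrable_nwt_mul hw hb hwb m1 b1) (integrable_nwt_mul hw hb hwb m2 b2)]
      simp only [poisson]
      ring
    have h0 : 0 ≤ (1 - ε) ^ J := (abs_nonneg _).trans (ih x)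
    rw [e, pow_succ']
    refine h1.trans ?_
    gcongr

/-- `poisson` solves the Poisson equation up to an error `2 (1 - ε) ^ J`. -/
theorem abs_poisson_equation_le (J : ℕ) (x : Z) :
    |f x - (∫ y, nwt w b y * f y ∂ν) / (∫ y, nwt w b y ∂ν) -
      (poisson w b f J ν x - ∫ y, poisson w b f J ν y ∂(mh w ν x))| ≤ 2 * (1 - ε) ^ J := by
  have m1 := measurable_poisson_right (b := b) hw hf (J + 1) ν
  have m2 := measurable_poisson_right (b := b) hw hf J ν
  have b1 := abs_poisson_le hw hb hwb hf hf1 (J + 1) ν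
  have b2 := abs_poisson_le hw hb hwb hf hf1 J ν
  have hr := abs_poisson_succ_sub_le hw hb hwb hf hf1 hν J
  set c := ∫ y, nwt w b y * poisson w b f J ν y ∂ν with hc
  set r := fun x => poisson w b f (J + 1) ν x - poisson w b f J ν x with hrdef
  have mr : Measurable r := m1.sub m2
  have e : ∀ x, f x - c - r x = poisson w b f J ν x - ∫ y, poisson w b f J ν y ∂(mh w ν x) :=
    fun x => by simp only [hrdef, hc, poisson]; ring
  have hinv := integral_nwt_mul_sub_mh hw hb hwb (ν := ν) m2 b2
  simp_rw [← e, mul_sub] at hinv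
  have i1 := integrable_nwt_mul hw hb hwb (ν := ν) hf hf1
  have i2 := (integrable_nwt hw hb hwb (ν := ν)).mul_const c
  have i3 := integrable_nwt_mul hw hb hwb (ν := ν) mr hr
  have i12 : Integrable (fun x => nwt w b x * f x - nwt w b x * c) ν := i1.sub i2
  rw [integral_sub i12 i3, integral_sub i1 i2, integral_mul_const] at hinv
  have hu : 0 < ∫ y, nwt w b y ∂ν := hε.trans_le hν
  have h3 : |(∫ y, nwt w b y * r y ∂ν) / ∫ y, nwt w b y ∂ν| ≤ (1 - ε) ^ J := by
    rw [abs_div, abs_of_pos hu, div_le_iff₀ hu]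
    refine abs_integral_le_integral_abs.trans ?_
    rw [← integral_const_mul]
    refine integral_mono i3.abs ((integrable_nwt hw hb hwb).const_mul _) fun y => ?_
    simp only
    rw [abs_mul, abs_of_nonneg (nwt_nonneg hb y), mul_comm]
    exact mul_le_mul_of_nonneg_right (hr y) (nwt_nonneg hb y)
  have e2 : (∫ y, nwt w b y * f y ∂ν) / (∫ y, nwt w b y ∂ν) =
      c + (∫ y, nwt w b y * r y ∂ν) / ∫ y, nwt w b y ∂ν := by
    field_simp; linarith
  rw [← e, e2]
  have := hr x
  change |r x| ≤ _ at this
  rw [abs_le] at *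
  constructor <;> linarith [h3.1, h3.2, this.1, this.2]

variable {ν' : Measure Z} [IsProbabilityMeasure ν'] (hν' : ε ≤ ∫ y, nwt w b y ∂ν') {η : ℝ}
  (hη : ∀ g : Z → ℝ, Measurable g → (∀ z, |g z| ≤ 1) → |∫ z, g z ∂ν - ∫ z, g z ∂ν'| ≤ η)

include hν' hη

theorem abs_poisson_sub_le (J : ℕ) (x : Z) :
    |poisson w b f J ν x - poisson w b f J ν' x| ≤ 2 * η / ε ^ 2 := by
  have hη0 : 0 ≤ η := (abs_nonneg _).trans (hη (fun _ => 0) measurable_const (by simp))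
  induction J generalizing x with
  | zero => simp [poisson]; positivity
  | succ J ih =>
    have m1 := measurable_poisson_right (b := b) hw hf J ν
    have m2 := measurable_poisson_right (b := b) hw hf J ν'
    have b1 := abs_poisson_le hw hb hwb hf hf1 J ν
    have b2 := abs_poisson_le hw hb hwb hf hf1 J ν'
    have h1 := abs_residual_le hw hb hwb (ν := ν) x (m1.sub m2) ih
    have h2 := abs_residual_sub_le hw hb hwb hη x m2 (one_div_pos.2 hε)
      (abs_poisson_le_inv hw hb hwb hf hf1 hε hν' J)
    simp only [Pi.sub_apply, mul_sub] at h1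
    rw [integral_sub (integrable_of_abs_le m1 b1) (integrable_of_abs_le m2 b2),
      integral_sub (integrable_nwt_mul hw hb hwb m1 b1)
        (integrable_nwt_mul hw hb hwb m2 b2)] at h1
    have h3 : (1 - ∫ y, nwt w b y ∂ν) * (2 * η / ε ^ 2) ≤ (1 - ε) * (2 * η / ε ^ 2) := by gcongr
    have h4 : (1 - ε) * (2 * η / ε ^ 2) + 2 * (1 / ε) * η = 2 * η / ε ^ 2 := by
      field_simp; ring
    simp only [poisson]
    rw [abs_le] at *
    constructor <;> linarith [h1.1, h1.2, h2.1, h2.2]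

theorem abs_integral_mh_poisson_sub_le (hε1 : ε ≤ 1) (J : ℕ) (x : Z) :
    |∫ y, poisson w b f J ν y ∂(mh w ν x) - ∫ y, poisson w b f J ν' y ∂(mh w ν' x)| ≤
      4 * η / ε ^ 2 := by
  have hη0 : 0 ≤ η := (abs_nonneg _).trans (hη (fun _ => 0) measurable_const (by simp))
  have m1 := measurable_poisson_right (b := b) hw hf J ν
  have m2 := measurable_poisson_right (b := b) hw hf J ν'
  have b1 := abs_poisson_le hw hb hwb hf hf1 J ν
  have b2 := abs_poisson_le hw hb hwb hf hf1 J ν'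
  have h1 := abs_integral_le_of_abs_le (ν := mh w ν x)
    (abs_poisson_sub_le hw hb hwb hf hf1 hε hν hν' hη J)
  rw [integral_sub (integrable_of_abs_le m1 b1) (integrable_of_abs_le m2 b2)] at h1
  have h2 := abs_integral_mh_sub_le hw hη x m2 (one_div_pos.2 hε)
    (abs_poisson_le_inv hw hb hwb hf hf1 hε hν' J)
  have h3 : 2 * (1 / ε) * η ≤ 2 * η / ε ^ 2 := by
    rw [show 2 * (1 / ε) * η = 2 * η * ε / ε ^ 2 by field_simp]
    exact div_le_div_of_nonneg_right (by nlinarith) (by positivity)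
  have h4 : 4 * η / ε ^ 2 = 2 * η / ε ^ 2 + 2 * η / ε ^ 2 := by ring
  rw [h4]
  exact (abs_sub_le _ _ _).trans (add_le_add h1 (h2.trans h3))

end PoissonEquation

section AdaptiveChain

open ProbabilityTheory

variable {Ω Z : Type*} [mΩ : MeasurableSpace Ω] [MeasurableSpace Z]
  {μ : Measure Ω} [IsProbabilityMeasure μ] {w : Z → ℝ≥0∞} {b : ℝ}

theorem measurable_integral_probMeas {g : Z → ℝ} (hg : Measurable g) :
    Measurable fun ν : ProbMeas Z => ∫ y, g y ∂ν.1 := by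
  have : StronglyMeasurable (Function.uncurry fun (_ : ProbMeas Z) (y : Z) => g y) :=
    (hg.comp measurable_snd).stronglyMeasurable
  exact (this.integral_kernel_prod_right (κ := evalKernel Z)).measurable

theorem exists_pow_le_one_div {ε : ℝ} (hε : 0 < ε) (N : ℕ) :
    ∃ J : ℕ, (1 - ε) ^ J ≤ 1 / ((N : ℝ) + 1) := by
  obtain ⟨J, hJ⟩ := exists_pow_lt_of_lt_one (show (0 : ℝ) < 1 / ((N : ℝ) + 1) by positivity)
    (show 1 - ε < 1 by linarith)
  exact ⟨J, hJ.le⟩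

theorem sum_telescope (a c c' : ℕ → ℝ) (N : ℕ) :
    ∑ k ∈ Finset.range (N + 1), (a k - c k) =
      a 0 - c N + ∑ k ∈ Finset.range N, (a (k + 1) - c' k) +
        ∑ k ∈ Finset.range N, (c' k - c k) := by
  induction N with
  | zero => simp
  | succ N ih => rw [Finset.sum_range_succ, ih, Finset.sum_range_succ, Finset.sum_range_succ]; ring

/-- The increments of the martingale part of an adaptive Metropolis–Hastings chain. -/
def increment (w : Z → ℝ≥0∞) (b : ℝ) (f : Z → ℝ) (J : ℕ) (X : ℕ → Ω → Z)
    (Q : ℕ → Ω → ProbMeas Z) (k : ℕ) (ω : Ω) : ℝ :=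
  poisson w b f J (Q (k + 1) ω).1 (X (k + 1) ω) -
    ∫ y, poisson w b f J (Q (k + 1) ω).1 y ∂(mh w (Q (k + 1) ω).1 (X k ω))

omit mΩ in
theorem measurable_increment {m : MeasurableSpace Ω} (hw : Measurable w) {f : Z → ℝ}
    (hf : Measurable f) (J : ℕ) {X : ℕ → Ω → Z} {Q : ℕ → Ω → ProbMeas Z} {k : ℕ}
    (hX : Measurable (X k)) (hX' : Measurable (X (k + 1))) (hQ : Measurable (Q (k + 1))) :
    Measurable (increment w b f J X Q k) := by
  have h1 := (measurable_poisson (b := b) hw hf J).comp (hQ.prodMk hX')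
  have h2 := (measurable_integral_mh hw (measurable_poisson (b := b) hw hf J)).comp
    (hQ.prodMk hX)
  exact h1.sub h2

/-- Moment bound for the averages of a Metropolis–Hastings chain whose proposal is adapted
with vanishing adaptation. -/
theorem rpow_integral_average_sub_le (hw : Measurable w) (hb : 0 < b)
    (hwb : ∀ z, w z ≤ ENNReal.ofReal b) {f : Z → ℝ} (hf : Measurable f) (hf1 : ∀ z, |f z| ≤ 1)
    {F : ℕ → MeasurableSpace Ω} (hF : ∀ k, F k ≤ mΩ) {X : ℕ → Ω → Z}
    (hX : ∀ k, Measurable (X k)) (hXF : ∀ j k, j < k → Measurable[F k] (X j))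
    {Q : ℕ → Ω → ProbMeas Z} (hQF : ∀ j k, j ≤ k → Measurable[F k] (Q j))
    (hQLip : ∀ k ω (g : Z → ℝ), Measurable g → (∀ z, |g z| ≤ 1) →
      |∫ z, g z ∂(Q (k + 1) ω).1 - ∫ z, g z ∂(Q k ω).1| ≤ 2 / ((k : ℝ) + 1))
    {ε : ℝ} (hε : 0 < ε) (hε1 : ε ≤ 1)
    (hQε : ∀ᵐ ω ∂μ, ∀ k, ε ≤ ∫ z, nwt w b z ∂(Q k ω).1)
    (hker : ∀ k (g : Z → ℝ), Measurable g → (∀ z, |g z| ≤ 1) →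
      μ[fun ω => g (X (k + 1) ω)|F (k + 1)] =ᵐ[μ]
        fun ω => ∫ z, g z ∂(mh w (Q (k + 1) ω).1 (X k ω)))
    {p : ℝ} (hp : 1 ≤ p) (N : ℕ) :
    (∫ ω, |((N : ℝ) + 1)⁻¹ * ∑ k ∈ Finset.range (N + 1), (f (X k ω) -
      (∫ z, nwt w b z * f z ∂(Q k ω).1) / ∫ z, nwt w b z ∂(Q k ω).1)| ^ p ∂μ) ^ (1 / p) ≤
      28 / ε ^ 2 * p / √((N : ℝ) + 1) := by
  obtain ⟨J, hJ⟩ := exists_pow_le_one_div hε N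
  have hprob : ∀ k ω, IsProbabilityMeasure (Q k ω).1 := fun k ω => (Q k ω).2
  have hQ : ∀ k, Measurable (Q k) := fun k => (hQF k k le_rfl).mono (hF k) le_rfl
  set D := increment w b f J X Q with hD
  have mD : ∀ k, Measurable (D k) := fun k =>
    measurable_increment hw hf J (hX k) (hX _) (hQ _)
  have mDF : ∀ j k, j < k → Measurable[F (k + 1)] (D j) := fun j k hjk =>
    measurable_increment hw hf J (hXF _ _ (by omega)) (hXF _ _ (by omega)) (hQF _ _ (by omega))
  have bD : ∀ k, ∀ᵐ ω ∂μ, |D k ω| ≤ 2 / ε := fun k => by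
    filter_upwards [hQε] with ω hω
    have h1 := abs_poisson_le_inv hw hb hwb hf hf1 hε (hω (k + 1)) J
    refine (abs_sub _ _).trans ?_
    have h2 := abs_integral_le_of_abs_le (ν := mh w (Q (k + 1) ω).1 (X k ω)) h1
    have h3 : 2 / ε = 1 / ε + 1 / ε := by ring
    rw [h3]
    exact add_le_add (h1 _) h2
  have hDc : ∀ t : ℝ, ∀ k,
      ∫ ω, Real.exp (t * ∑ j ∈ Finset.range k, D j ω) * D k ω ∂μ = 0 := fun t k => by
    let Y : Ω → ℝ × (ProbMeas Z × Z) := fun ω =>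
      (Real.exp (t * ∑ j ∈ Finset.range k, D j ω), (Q (k + 1) ω, X k ω))
    have hY : Measurable[F (k + 1)] Y := by
      refine Measurable.prodMk (Real.measurable_exp.comp (Measurable.const_mul ?_ t))
        ((hQF _ _ le_rfl).prodMk (hXF _ _ (by omega)))
      exact Finset.measurable_fun_sum _ fun j hj => mDF j k (Finset.mem_range.1 hj)
    let G : (ℝ × (ProbMeas Z × Z)) × Z → ℝ := fun v =>
      v.1.1 * (poisson w b f J v.1.2.1.1 v.2 -
        ∫ y, poisson w b f J v.1.2.1.1 y ∂(mh w v.1.2.1.1 v.1.2.2))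
    have hG : Measurable G := by
      refine (measurable_fst.comp measurable_fst).mul (Measurable.sub ?_ ?_)
      · exact (measurable_poisson hw hf J).comp
          ((measurable_fst.comp (measurable_snd.comp measurable_fst)).prodMk measurable_snd)
      · exact (measurable_integral_mh hw (measurable_poisson hw hf J)).comp
          (measurable_snd.comp measurable_fst)
    refine integral_comp_eq_zero (X := X (k + 1)) (Y := Y) (G := G) (hF (k + 1)) (hX _) hY
      ((mhKernel hw).comap Prod.snd measurable_snd) ?_ hG ?_ ?_
    · intro s hs
      have h1 := hker k (s.indicator fun _ => (1 : ℝ)) (measurable_one.indicator hs) fun z => by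
        by_cases hz : z ∈ s <;> simp [hz]
      refine h1.trans (Filter.Eventually.of_forall fun ω => ?_)
      simp only [integral_indicator_const _ hs, smul_eq_mul, mul_one]
      rfl
    · exact (integrable_exp_sum mD bD t k).mul_bdd (mD k).aestronglyMeasurable
        ((bD k).mono fun ω hω => hω)
    · rintro ⟨u, ν, x⟩
      have : IsProbabilityMeasure ν.1 := ν.2
      have hi : Integrable (poisson w b f J ν.1) (mh w ν.1 x) :=
        integrable_of_abs_le (measurable_poisson_right hw hf J ν.1)
          (abs_poisson_le hw hb hwb hf hf1 J ν.1)
      change ∫ z, u * (poisson w b f J ν.1 z - ∫ y, poisson w b f J ν.1 y ∂(mh w ν.1 x))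
        ∂(mh w ν.1 x) = 0
      rw [integral_const_mul, integral_sub hi (integrable_const _)]
      simp
  have hmart := integral_abs_sum_rpow_le mD (show 0 < 2 / ε by positivity) bD hDc hp N
  set R : ℕ → Ω → ℝ := fun k ω => f (X k ω) -
    (∫ z, nwt w b z * f z ∂(Q k ω).1) / ∫ z, nwt w b z ∂(Q k ω).1 with hR
  have mR : ∀ k, Measurable (R k) := fun k => (hf.comp (hX k)).sub
    (((measurable_integral_probMeas ((measurable_nwt hw).mul hf)).comp (hQ k)).div
      ((measurable_integral_probMeas (measurable_nwt hw)).comp (hQ k)))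
  have hpath : ∀ᵐ ω ∂μ, |∑ k ∈ Finset.range (N + 1), R k ω| ≤
      |∑ k ∈ Finset.range N, D k ω| + (20 / ε ^ 2) * √((N : ℝ) + 1) := by
    filter_upwards [hQε] with ω hω
    let a : ℕ → ℝ := fun k => poisson w b f J (Q k ω).1 (X k ω)
    let c : ℕ → ℝ := fun k => ∫ y, poisson w b f J (Q k ω).1 y ∂(mh w (Q k ω).1 (X k ω))
    let c' : ℕ → ℝ := fun k =>
      ∫ y, poisson w b f J (Q (k + 1) ω).1 y ∂(mh w (Q (k + 1) ω).1 (X k ω))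
    have htel := sum_telescope a c c' N
    have ha : |a 0| ≤ 1 / ε := abs_poisson_le_inv hw hb hwb hf hf1 hε (hω 0) J _
    have hc : |c N| ≤ 1 / ε :=
      abs_integral_le_of_abs_le (abs_poisson_le_inv hw hb hwb hf hf1 hε (hω N) J)
    have hcc : |∑ k ∈ Finset.range N, (c' k - c k)| ≤ 16 / ε ^ 2 * √N := by
      calc |∑ k ∈ Finset.range N, (c' k - c k)|
          ≤ ∑ k ∈ Finset.range N, |c' k - c k| := Finset.abs_sum_le_sum_abs _ _
        _ ≤ ∑ k ∈ Finset.range N, 8 / ε ^ 2 * (1 / ((k : ℝ) + 1)) := by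
          refine Finset.sum_le_sum fun k _ => ?_
          refine (abs_integral_mh_poisson_sub_le hw hb hwb hf hf1 hε (hω (k + 1)) (hω k)
            (hQLip k ω) hε1 J (X k ω)).trans (le_of_eq ?_)
          field_simp
          norm_num
        _ ≤ 8 / ε ^ 2 * (2 * √N) := by
          rw [← Finset.mul_sum]
          exact mul_le_mul_of_nonneg_left (sum_one_div_succ_le N) (by positivity)
        _ = _ := by ring
    have herr : |∑ k ∈ Finset.range (N + 1), R k ω -
        ∑ k ∈ Finset.range (N + 1), (a k - c k)| ≤ 2 := by
      rw [← Finset.sum_sub_distrib]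
      calc |∑ k ∈ Finset.range (N + 1), (R k ω - (a k - c k))|
          ≤ ∑ k ∈ Finset.range (N + 1), |R k ω - (a k - c k)| := Finset.abs_sum_le_sum_abs _ _
        _ ≤ ∑ k ∈ Finset.range (N + 1), 2 * (1 / ((N : ℝ) + 1)) := by
          refine Finset.sum_le_sum fun k _ => ?_
          refine (abs_poisson_equation_le hw hb hwb hf hf1 hε (hω k) J (X k ω)).trans ?_
          linarith
        _ = 2 := by
          rw [Finset.sum_const, Finset.card_range, nsmul_eq_mul]
          push_cast
          field_simp
    have hDs : ∑ k ∈ Finset.range N, (a (k + 1) - c' k) = ∑ k ∈ Finset.range N, D k ω := rfl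
    rw [hDs] at htel
    rw [htel] at herr
    have hN1 : (1 : ℝ) ≤ √((N : ℝ) + 1) := Real.one_le_sqrt.2 (by simp)
    have hNN : √(N : ℝ) ≤ √((N : ℝ) + 1) := Real.sqrt_le_sqrt (by simp)
    have he : 1 / ε ≤ 1 / ε ^ 2 := one_div_le_one_div_of_le (by positivity) (by nlinarith)
    have he1 : 1 ≤ 1 / ε ^ 2 := by
      rw [le_div_iff₀ (by positivity)]
      nlinarith
    have h16 : 16 / ε ^ 2 * √N ≤ 16 / ε ^ 2 * √((N : ℝ) + 1) := by gcongr
    have h4 : 4 * (1 / ε ^ 2) ≤ 4 / ε ^ 2 * √((N : ℝ) + 1) := by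
      rw [mul_one_div]
      exact le_mul_of_one_le_right (by positivity) hN1
    have hsplit : 20 / ε ^ 2 * √((N : ℝ) + 1) =
      16 / ε ^ 2 * √((N : ℝ) + 1) + 4 / ε ^ 2 * √((N : ℝ) + 1) := by ring
    have t1 := abs_sub_abs_le_abs_sub (∑ k ∈ Finset.range (N + 1), R k ω)
      (a 0 - c N + ∑ k ∈ Finset.range N, D k ω + ∑ k ∈ Finset.range N, (c' k - c k))
    have t2 := abs_add_le (a 0 - c N + ∑ k ∈ Finset.range N, D k ω)
      (∑ k ∈ Finset.range N, (c' k - c k))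
    have t3 := abs_add_le (a 0 - c N) (∑ k ∈ Finset.range N, D k ω)
    have t4 := abs_sub (a 0) (c N)
    linarith
  have hadd := rpow_integral_le_add_const (μ := μ)
    (Finset.measurable_fun_sum (Finset.range (N + 1)) fun k _ => mR k)
    (Finset.measurable_fun_sum (Finset.range N) fun k _ => mD k)
    (ae_abs_sum_le bD N) (show (0 : ℝ) ≤ (20 / ε ^ 2) * √((N : ℝ) + 1) by positivity) hpath hp
  rw [rpow_integral_const_mul (by positivity) hp]
  have hfin : 4 * p * (2 / ε) * √((N : ℝ) + 1) + 20 / ε ^ 2 * √((N : ℝ) + 1) ≤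
      28 / ε ^ 2 * p * √((N : ℝ) + 1) := by
    rw [← add_mul]
    refine mul_le_mul_of_nonneg_right ?_ (by positivity)
    have he : 1 / ε ≤ 1 / ε ^ 2 := one_div_le_one_div_of_le (by positivity) (by nlinarith)
    have h1 : 4 * p * (2 / ε) ≤ 8 * p * (1 / ε ^ 2) := by
      rw [show 4 * p * (2 / ε) = 8 * p * (1 / ε) by ring]
      gcongr
    have h2 : 20 / ε ^ 2 ≤ 20 * p * (1 / ε ^ 2) := by
      rw [show 20 * p * (1 / ε ^ 2) = 20 / ε ^ 2 * p by ring]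
      exact le_mul_of_one_le_right (by positivity) hp
    rw [show 28 / ε ^ 2 * p = 8 * p * (1 / ε ^ 2) + 20 * p * (1 / ε ^ 2) by ring]
    exact add_le_add h1 h2
  calc ((N : ℝ) + 1)⁻¹ * (∫ ω, |∑ k ∈ Finset.range (N + 1), R k ω| ^ p ∂μ) ^ (1 / p)
      ≤ ((N : ℝ) + 1)⁻¹ * (28 / ε ^ 2 * p * √((N : ℝ) + 1)) :=
        mul_le_mul_of_nonneg_left (by linarith) (by positivity)
    _ = 28 / ε ^ 2 * p / √((N : ℝ) + 1) := by
      have hs := Real.sq_sqrt (show (0 : ℝ) ≤ (N : ℝ) + 1 by positivity)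
      have hs0 : 0 < √((N : ℝ) + 1) := by positivity
      rw [← hs]
      rw [Real.sqrt_sq hs0.le]
      field_simp

end AdaptiveChain

section Empirical

open ProbabilityTheory

variable {S Z : Type*} [MeasurableSpace S] [MeasurableSpace Z]

/-- The empirical measure of the first `k + 1` terms of a sequence. -/
def empirical (y : ℕ → S) (k : ℕ) : Measure S :=
  ((k : ℝ≥0∞) + 1)⁻¹ • ∑ j ∈ Finset.range (k + 1), Measure.dirac (y j)

theorem lintegral_empirical (y : ℕ → S) (k : ℕ) {g : S → ℝ≥0∞} (hg : Measurable g) :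
    ∫⁻ x, g x ∂(empirical y k) =
      ((k : ℝ≥0∞) + 1)⁻¹ * ∑ j ∈ Finset.range (k + 1), g (y j) := by
  simp [empirical, lintegral_smul_measure, lintegral_finsetSum_measure, lintegral_dirac' _ hg]

instance (y : ℕ → S) (k : ℕ) : IsProbabilityMeasure (empirical y k) := by
  refine ⟨?_⟩
  have := lintegral_empirical y k (g := fun _ => 1) measurable_const
  rw [lintegral_one] at this
  rw [this]
  simp only [Finset.sum_const, Finset.card_range, nsmul_eq_mul, mul_one]
  push_cast
  exact ENNReal.inv_mul_cancel (by simp) (by finiteness)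

theorem integral_empirical (y : ℕ → S) (k : ℕ) {g : S → ℝ} (hg : Measurable g) :
    ∫ x, g x ∂(empirical y k) = ((k : ℝ) + 1)⁻¹ * ∑ j ∈ Finset.range (k + 1), g (y j) := by
  rw [empirical, integral_smul_measure, integral_finsetSum_measure]
  · simp_rw [integral_dirac' g _ hg.stronglyMeasurable]
    rw [ENNReal.toReal_inv, ENNReal.toReal_add (by finiteness) (by finiteness)]
    simp
  · exact fun j _ => integrable_dirac' hg.stronglyMeasurable (by simp)

theorem abs_integral_empirical_succ_sub_le (y : ℕ → S) (k : ℕ) {g : S → ℝ} (hg : Measurable g)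
    (hg1 : ∀ x, |g x| ≤ 1) :
    |∫ x, g x ∂(empirical y (k + 1)) - ∫ x, g x ∂(empirical y k)| ≤ 2 / ((k : ℝ) + 1) := by
  have h1 := abs_integral_le_of_abs_le (ν := empirical y k) hg1
  rw [integral_empirical y k hg] at h1 ⊢
  rw [integral_empirical y (k + 1) hg, Finset.sum_range_succ _ (k + 1)]
  set s := ∑ j ∈ Finset.range (k + 1), g (y j)
  have hk : (0 : ℝ) < (k : ℝ) + 1 := by positivity
  have e : ((k + 1 : ℕ) + 1 : ℝ)⁻¹ * (s + g (y (k + 1))) - ((k : ℝ) + 1)⁻¹ * s =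
      ((k : ℝ) + 2)⁻¹ * (g (y (k + 1)) - ((k : ℝ) + 1)⁻¹ * s) := by
    push_cast
    field_simp
    ring
  rw [e, abs_mul, abs_of_pos (by positivity)]
  have h2 : |g (y (k + 1)) - ((k : ℝ) + 1)⁻¹ * s| ≤ 2 :=
    (abs_sub _ _).trans (by linarith [hg1 (y (k + 1))])
  calc ((k : ℝ) + 2)⁻¹ * |g (y (k + 1)) - ((k : ℝ) + 1)⁻¹ * s|
      ≤ ((k : ℝ) + 1)⁻¹ * 2 := by gcongr; norm_num
    _ = 2 / ((k : ℝ) + 1) := by ring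

theorem integral_bind_kernel (κ : Kernel S Z) [IsMarkovKernel κ] (ν : Measure S)
    [IsProbabilityMeasure ν] {g : Z → ℝ} (hg : Measurable g) {M : ℝ} (hM : ∀ z, |g z| ≤ M) :
    ∫ z, g z ∂(ν.bind κ) = ∫ x, ∫ z, g z ∂(κ x) ∂ν := by
  rw [← Measure.snd_compProd, Measure.snd, integral_map measurable_snd.aemeasurable
    hg.aestronglyMeasurable, Measure.integral_compProd]
  exact integrable_of_abs_le (hg.comp measurable_snd) fun z => hM z.2

theorem measurable_integral_kernel (κ : Kernel S Z) [IsMarkovKernel κ] {g : Z → ℝ}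
    (hg : Measurable g) : Measurable fun x => ∫ z, g z ∂(κ x) := by
  have : StronglyMeasurable (Function.uncurry fun (_ : S) (y : Z) => g y) :=
    (hg.comp measurable_snd).stronglyMeasurable
  exact (this.integral_kernel_prod_right (κ := κ)).measurable

theorem isProbabilityMeasure_bind (κ : Kernel S Z) [IsMarkovKernel κ] (ν : Measure S)
    [IsProbabilityMeasure ν] : IsProbabilityMeasure (ν.bind κ) := by
  infer_instance

/-- The proposals obtained by applying a kernel to the empirical measures of a chain. -/
def empiricalProposal {Ω : Type*} (κ : Kernel S Z) [IsMarkovKernel κ] (Y : ℕ → Ω → S) (k : ℕ)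
    (ω : Ω) : ProbMeas Z :=
  ⟨(empirical (fun j => Y j ω) k).bind κ, isProbabilityMeasure_bind κ _⟩

theorem measurable_empiricalProposal {Ω : Type*} {m : MeasurableSpace Ω} (κ : Kernel S Z)
    [IsMarkovKernel κ] {Y : ℕ → Ω → S} {k : ℕ} (hY : ∀ j ≤ k, Measurable (Y j)) :
    Measurable (empiricalProposal κ Y k) := by
  refine Measurable.subtype_mk (Measure.measurable_of_measurable_coe _ fun s hs => ?_)
  have : ∀ ω, ((empirical (fun j => Y j ω) k).bind κ) s =
      ((k : ℝ≥0∞) + 1)⁻¹ * ∑ j ∈ Finset.range (k + 1), κ (Y j ω) s := fun ω => by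
    rw [Measure.bind_apply hs κ.aemeasurable, lintegral_empirical _ _ (κ.measurable_coe hs)]
  simp_rw [this]
  refine Measurable.const_mul (Finset.measurable_fun_sum _ fun j hj => ?_) _
  exact (κ.measurable_coe hs).comp (hY j (by simpa [Nat.lt_succ_iff] using hj))

end Empirical

section Averages

variable {Ω : Type*} [MeasurableSpace Ω] {μ : Measure Ω} [IsProbabilityMeasure μ]

theorem rpow_integral_average_abs_le {U : ℕ → Ω → ℝ} (hU : ∀ k, Measurable (U k)) {M : ℝ}
    (hM : ∀ k ω, |U k ω| ≤ M) {p C : ℝ} (hp : 1 ≤ p) (hC : 0 ≤ C)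
    (h : ∀ k, (∫ ω, |U k ω| ^ p ∂μ) ^ (1 / p) ≤ C / √((k : ℝ) + 1)) (N : ℕ) :
    (∫ ω, |((N : ℝ) + 1)⁻¹ * ∑ k ∈ Finset.range (N + 1), (|U k ω|)| ^ p ∂μ) ^ (1 / p) ≤
      2 * C / √((N : ℝ) + 1) := by
  rw [rpow_integral_const_mul (by positivity) hp]
  have h1 := rpow_integral_le_sum (μ := μ) (Finset.range (N + 1))
    (Y := fun ω => ∑ k ∈ Finset.range (N + 1), |U k ω|)
    (Finset.measurable_fun_sum _ fun k _ => (hU k).abs) (V := U) (fun k _ => hU k)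
    (C := fun _ => M) (fun k _ => Filter.Eventually.of_forall (hM k))
    (Filter.Eventually.of_forall fun ω =>
      (abs_of_nonneg (Finset.sum_nonneg fun k _ => abs_nonneg (U k ω))).le) hp
  have h2 : ∑ k ∈ Finset.range (N + 1), (∫ ω, |U k ω| ^ p ∂μ) ^ (1 / p) ≤
      C * (2 * √((N : ℝ) + 1)) := by
    refine (Finset.sum_le_sum fun k _ => h k).trans ?_
    simp_rw [div_eq_mul_one_div C]
    rw [← Finset.mul_sum]
    have := sum_one_div_sqrt_le (N + 1)
    push_cast at this
    exact mul_le_mul_of_nonneg_left this hC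
  have hs := Real.sq_sqrt (show (0 : ℝ) ≤ (N : ℝ) + 1 by positivity)
  have hs0 : 0 < √((N : ℝ) + 1) := by positivity
  calc _ ≤ ((N : ℝ) + 1)⁻¹ * (C * (2 * √((N : ℝ) + 1))) :=
        mul_le_mul_of_nonneg_left (h1.trans h2) (by positivity)
    _ = _ := by
      rw [← hs, Real.sqrt_sq hs0.le]
      field_simp

/-- Comparison of the averages of `a` with a constant through random centerings `r`. -/
theorem rpow_integral_average_sub_const_le {a r U V : ℕ → Ω → ℝ} (ha : ∀ k, Measurable (a k))
    (hr : ∀ k, Measurable (r k)) (hU : ∀ k, Measurable (U k)) (hV : ∀ k, Measurable (V k))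
    {M : ℝ} (hMU : ∀ k ω, |U k ω| ≤ M) (hMV : ∀ k ω, |V k ω| ≤ M)
    {A : ℝ} (hA : ∀ k, ∀ᵐ ω ∂μ, |a k ω - r k ω| ≤ A) {c ε : ℝ} (hε : 0 < ε)
    (hrc : ∀ k, ∀ᵐ ω ∂μ, |r k ω - c| ≤ ε⁻¹ * (|U k ω| + |V k ω|))
    {p C K : ℝ} (hp : 1 ≤ p) (hC : 0 ≤ C)
    (hUC : ∀ k, (∫ ω, |U k ω| ^ p ∂μ) ^ (1 / p) ≤ C / √((k : ℝ) + 1))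
    (hVC : ∀ k, (∫ ω, |V k ω| ^ p ∂μ) ^ (1 / p) ≤ C / √((k : ℝ) + 1)) (N : ℕ)
    (hK : (∫ ω, |((N : ℝ) + 1)⁻¹ * ∑ k ∈ Finset.range (N + 1), (a k ω - r k ω)| ^ p ∂μ) ^ (1 / p) ≤
      K / √((N : ℝ) + 1)) :
    (∫ ω, |((N : ℝ) + 1)⁻¹ * (∑ k ∈ Finset.range (N + 1), a k ω) - c| ^ p ∂μ) ^ (1 / p) ≤
      (K + 4 / ε * C) / √((N : ℝ) + 1) := by
  have hN : (0 : ℝ) < (N : ℝ) + 1 := by positivity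
  let av : (ℕ → Ω → ℝ) → Ω → ℝ := fun u ω =>
    ((N : ℝ) + 1)⁻¹ * ∑ k ∈ Finset.range (N + 1), u k ω
  have mav : ∀ u : ℕ → Ω → ℝ, (∀ k, Measurable (u k)) → Measurable (av u) := fun u hu =>
    (Finset.measurable_fun_sum _ fun k _ => hu k).const_mul _
  have bav : ∀ (u : ℕ → Ω → ℝ) (L : ℝ) (ω : Ω), (∀ k, |u k ω| ≤ L) → |av u ω| ≤ L :=
    fun u L ω hu => by
      simp only [av]
      rw [abs_mul, abs_of_pos (inv_pos.2 hN), inv_mul_le_iff₀ hN]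
      refine (Finset.abs_sum_le_sum_abs _ _).trans ((Finset.sum_le_sum fun k _ => hu k).trans ?_)
      simp
  let W : Fin 3 → Ω → ℝ := ![av fun k ω => a k ω - r k ω,
    fun ω => ε⁻¹ * av (fun k ω => |U k ω|) ω, fun ω => ε⁻¹ * av (fun k ω => |V k ω|) ω]
  have hA' : ∀ᵐ ω ∂μ, ∀ k, |a k ω - r k ω| ≤ A := ae_all_iff.2 hA
  have hrc' : ∀ᵐ ω ∂μ, ∀ k, |r k ω - c| ≤ ε⁻¹ * (|U k ω| + |V k ω|) := ae_all_iff.2 hrc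
  have hε' : 0 < ε⁻¹ := inv_pos.2 hε
  have hmain := rpow_integral_le_sum (μ := μ) Finset.univ
    (Y := fun ω => ((N : ℝ) + 1)⁻¹ * (∑ k ∈ Finset.range (N + 1), a k ω) - c)
    ((mav a ha).sub_const c) (V := W)
    (fun i _ => by
      fin_cases i
      · exact mav _ fun k => (ha k).sub (hr k)
      · exact (mav _ fun k => (hU k).abs).const_mul _
      · exact (mav _ fun k => (hV k).abs).const_mul _)
    (C := ![A, ε⁻¹ * M, ε⁻¹ * M])
    (fun i _ => by
      fin_cases i
      · exact hA'.mono fun ω hω => bav (fun k ω => a k ω - r k ω) A ω hω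
      · refine Filter.Eventually.of_forall fun ω => ?_
        change |ε⁻¹ * av (fun k ω => |U k ω|) ω| ≤ ε⁻¹ * M
        rw [abs_mul, abs_of_pos hε']
        exact mul_le_mul_of_nonneg_left
          (bav (fun k ω => |U k ω|) M ω fun k => (abs_abs (U k ω)).le.trans (hMU k ω)) hε'.le
      · refine Filter.Eventually.of_forall fun ω => ?_
        change |ε⁻¹ * av (fun k ω => |V k ω|) ω| ≤ ε⁻¹ * M
        rw [abs_mul, abs_of_pos hε']
        exact mul_le_mul_of_nonneg_left
          (bav (fun k ω => |V k ω|) M ω fun k => (abs_abs (V k ω)).le.trans (hMV k ω)) hε'.le)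
    (by
      filter_upwards [hrc'] with ω hω
      rw [Fin.sum_univ_three]
      change |av a ω - c| ≤ |av (fun k ω => a k ω - r k ω) ω| +
        |ε⁻¹ * av (fun k ω => |U k ω|) ω| + |ε⁻¹ * av (fun k ω => |V k ω|) ω|
      have e : av a ω - c = av (fun k ω => a k ω - r k ω) ω + av (fun k ω => r k ω - c) ω := by
        simp only [av, Finset.sum_sub_distrib, Finset.sum_const, Finset.card_range, nsmul_eq_mul]
        push_cast
        field_simp
        ring
      have h1 : |av (fun k ω => r k ω - c) ω| ≤
          ε⁻¹ * av (fun k ω => |U k ω|) ω + ε⁻¹ * av (fun k ω => |V k ω|) ω := by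
        simp only [av]
        rw [abs_mul, abs_of_pos (inv_pos.2 hN)]
        have h2 : |∑ k ∈ Finset.range (N + 1), (r k ω - c)| ≤
            ∑ k ∈ Finset.range (N + 1), ε⁻¹ * (|U k ω| + |V k ω|) :=
          (Finset.abs_sum_le_sum_abs _ _).trans (Finset.sum_le_sum fun k _ => hω k)
        rw [← Finset.mul_sum, Finset.sum_add_distrib] at h2
        refine (mul_le_mul_of_nonneg_left h2 (inv_pos.2 hN).le).trans (le_of_eq ?_)
        ring
      rw [e]
      refine (abs_add_le _ _).trans ?_
      have h2 := le_abs_self (ε⁻¹ * av (fun k ω => |U k ω|) ω)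
      have h3 := le_abs_self (ε⁻¹ * av (fun k ω => |V k ω|) ω)
      linarith) hp
  refine hmain.trans ?_
  rw [Fin.sum_univ_three]
  have w1 : (∫ ω, |W 1 ω| ^ p ∂μ) ^ (1 / p) ≤ ε⁻¹ * (2 * C / √((N : ℝ) + 1)) :=
    (rpow_integral_const_mul hε'.le hp).trans_le (mul_le_mul_of_nonneg_left
      (rpow_integral_average_abs_le hU hMU hp hC hUC N) hε'.le)
  have w2 : (∫ ω, |W 2 ω| ^ p ∂μ) ^ (1 / p) ≤ ε⁻¹ * (2 * C / √((N : ℝ) + 1)) :=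
    (rpow_integral_const_mul hε'.le hp).trans_le (mul_le_mul_of_nonneg_left
      (rpow_integral_average_abs_le hV hMV hp hC hVC N) hε'.le)
  have e : (K + 4 / ε * C) / √((N : ℝ) + 1) = K / √((N : ℝ) + 1) +
      ε⁻¹ * (2 * C / √((N : ℝ) + 1)) + ε⁻¹ * (2 * C / √((N : ℝ) + 1)) := by
    field_simp
    ring
  rw [e]
  exact add_le_add (add_le_add hK w1) w2

end Averages

section OneLevel

open ProbabilityTheory

variable {Ω S Z : Type*} [mΩ : MeasurableSpace Ω] [MeasurableSpace S] [MeasurableSpace Z]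
  {μ : Measure Ω} [IsProbabilityMeasure μ] {w : Z → ℝ≥0∞} {b : ℝ}

theorem mh_zero_weight (hw : Measurable w) (ν : Measure Z) {x : Z} (hx : w x ≠ 0) :
    mh w ν x (w ⁻¹' {0}) = 0 := by
  have hs : MeasurableSet (w ⁻¹' {0}) := hw (measurableSet_singleton 0)
  have h1 : ∫⁻ y in w ⁻¹' {0}, acc w x y ∂ν = 0 := by
    rw [setLIntegral_congr_fun hs (g := fun _ => 0) fun y hy => ?_, lintegral_zero]
    have hy0 : w y = 0 := hy
    simp [acc, hy0]
  simp [mh, withDensity_apply _ hs, h1, Measure.dirac_apply' _ hs, hx]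

/-- A Metropolis–Hastings chain started where the weight is positive stays there. -/
theorem ae_weight_ne_zero (hw : Measurable w) {F : ℕ → MeasurableSpace Ω} (hF : ∀ k, F k ≤ mΩ)
    {X : ℕ → Ω → Z} (hX : ∀ k, Measurable (X k)) {Q : ℕ → Ω → ProbMeas Z}
    (hker : ∀ k (g : Z → ℝ), Measurable g → (∀ z, |g z| ≤ 1) →
      μ[fun ω => g (X (k + 1) ω)|F (k + 1)] =ᵐ[μ]
        fun ω => ∫ z, g z ∂(mh w (Q (k + 1) ω).1 (X k ω)))
    (h0 : ∀ ω, w (X 0 ω) ≠ 0) : ∀ᵐ ω ∂μ, ∀ k, w (X k ω) ≠ 0 := by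
  refine ae_all_iff.2 fun k => ?_
  induction k with
  | zero => exact Filter.Eventually.of_forall h0
  | succ k ih =>
    have hs : MeasurableSet (w ⁻¹' {0}) := hw (measurableSet_singleton 0)
    let g : Z → ℝ := (w ⁻¹' {0}).indicator fun _ => 1
    have hg : Measurable g := measurable_one.indicator hs
    have hg0 : ∀ z, 0 ≤ g z := Set.indicator_nonneg fun _ _ => zero_le_one
    have hg1 : ∀ z, |g z| ≤ 1 := fun z => by
      by_cases hz : z ∈ w ⁻¹' {0} <;> simp [g, hz]
    have hi : Integrable (fun ω => g (X (k + 1) ω)) μ :=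
      integrable_of_abs_le (hg.comp (hX _)) fun ω => hg1 _
    have hint : ∫ ω, g (X (k + 1) ω) ∂μ = 0 := by
      rw [← integral_condExp (hF (k + 1)), integral_congr_ae (hker k g hg hg1)]
      refine integral_eq_zero_of_ae ?_
      filter_upwards [ih] with ω hω
      simp [g, integral_indicator_const _ hs, measureReal_def, mh_zero_weight hw _ hω]
    have hz := (integral_eq_zero_iff_of_nonneg (fun ω => hg0 (X (k + 1) ω)) hi).1 hint
    filter_upwards [hz] with ω hω hw0
    have : g (X (k + 1) ω) = 1 := Set.indicator_of_mem (show X (k + 1) ω ∈ w ⁻¹' {0} from hw0) _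
    rw [this] at hω
    exact one_ne_zero hω

variable (hw : Measurable w) (hb : 0 < b)
    (hwb : ∀ z, w z ≤ ENNReal.ofReal b) {f : Z → ℝ} (hf : Measurable f) (hf1 : ∀ z, |f z| ≤ 1)
    {F : ℕ → MeasurableSpace Ω} (hF : ∀ k, F k ≤ mΩ) {X : ℕ → Ω → Z}
    (hX : ∀ k, Measurable (X k)) (hXF : ∀ j k, j < k → Measurable[F k] (X j))
    {ε : ℝ} (hε : 0 < ε) (hε1 : ε ≤ 1) {T : ℝ} (hT : 0 < T)
    {π' : Measure Z} [IsProbabilityMeasure π'] {p : ℝ} (hp : 1 ≤ p)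

include hw hb hwb hf hf1 hF hX hXF hε hε1 hT hp

/-- Moment bound for the averages of a Metropolis–Hastings chain with a fixed proposal. -/
theorem rpow_integral_average_le_of_fixed_proposal {ν : Measure Z} [hν : IsProbabilityMeasure ν]
    (hcons : ∀ g : Z → ℝ, Measurable g → (∀ z, |g z| ≤ 1) →
      ∫ z, nwt w b z * g z ∂ν = T * ∫ z, g z ∂π')
    (hεν : ε ≤ ∫ z, nwt w b z ∂ν)
    (hker : ∀ k (g : Z → ℝ), Measurable g → (∀ z, |g z| ≤ 1) →
      μ[fun ω => g (X (k + 1) ω)|F (k + 1)] =ᵐ[μ] fun ω => ∫ z, g z ∂(mh w ν (X k ω)))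
    (N : ℕ) :
    (∫ ω, |((N : ℝ) + 1)⁻¹ * (∑ k ∈ Finset.range (N + 1), f (X k ω)) - ∫ z, f z ∂π'| ^ p ∂μ) ^
      (1 / p) ≤ 28 / ε ^ 2 * p / √((N : ℝ) + 1) := by
  have h1 : ∫ z, nwt w b z ∂ν = T := by
    simpa using hcons (fun _ => 1) measurable_const (by simp)
  have h2 : (∫ z, nwt w b z * f z ∂ν) / ∫ z, nwt w b z ∂ν = ∫ z, f z ∂π' := by
    rw [hcons f hf hf1, h1, mul_div_cancel_left₀ _ hT.ne']
  have h := rpow_integral_average_sub_le (μ := μ) hw hb hwb hf hf1 hF hX hXF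
    (Q := fun _ _ => ⟨ν, hν⟩) (fun _ _ _ => measurable_const)
    (fun k ω g _ _ => by rw [sub_self, abs_zero]; positivity) hε hε1
    (Filter.Eventually.of_forall fun _ _ => hεν) hker hp N
  convert h using 8 with ω
  simp only [h2, Finset.sum_sub_distrib, Finset.sum_const, Finset.card_range, nsmul_eq_mul]
  push_cast
  field_simp

omit hT in
/-- Moment bound for the averages of a Metropolis–Hastings chain with proposal built from the
empirical measures of a chain satisfying such a bound. -/
theorem rpow_integral_average_le_of_empirical {κ : Kernel S Z} [IsMarkovKernel κ]
    {Y : ℕ → Ω → S} (hY : ∀ k, Measurable (Y k)) (hYF : ∀ j k, j ≤ k → Measurable[F k] (Y j))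
    {π : Measure S} [IsProbabilityMeasure π]
    (hcons : ∀ g : Z → ℝ, Measurable g → (∀ z, |g z| ≤ 1) →
      ∫ z, nwt w b z * g z ∂(π.bind κ) = T * ∫ z, g z ∂π')
    (hεκ : ∀ᵐ ω ∂μ, ∀ j, ε ≤ ∫ z, nwt w b z ∂(κ (Y j ω)))
    (hker : ∀ k (g : Z → ℝ), Measurable g → (∀ z, |g z| ≤ 1) →
      μ[fun ω => g (X (k + 1) ω)|F (k + 1)] =ᵐ[μ]
        fun ω => ∫ z, g z ∂(mh w ((empirical (fun j => Y j ω) (k + 1)).bind κ) (X k ω)))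
    {C : ℝ} (hC : 0 ≤ C)
    (hπ : ∀ g : S → ℝ, Measurable g → (∀ x, |g x| ≤ 1) → ∀ k : ℕ,
      (∫ ω, |((k : ℝ) + 1)⁻¹ * (∑ j ∈ Finset.range (k + 1), g (Y j ω)) - ∫ x, g x ∂π| ^ p ∂μ) ^
        (1 / p) ≤ C / √((k : ℝ) + 1))
    (N : ℕ) :
    (∫ ω, |((N : ℝ) + 1)⁻¹ * (∑ k ∈ Finset.range (N + 1), f (X k ω)) - ∫ z, f z ∂π'| ^ p ∂μ) ^
      (1 / p) ≤ (28 / ε ^ 2 * p + 4 / ε * C) / √((N : ℝ) + 1) := by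
  have hu := measurable_nwt (b := b) hw
  have hu1 := abs_nwt_le_one hb hwb
  have hnf : Measurable fun z => nwt w b z * f z := hu.mul hf
  have hnf1 : ∀ z, |nwt w b z * f z| ≤ 1 := fun z => by
    rw [abs_mul]
    exact mul_le_one₀ (hu1 z) (abs_nonneg _) (hf1 z)
  let em : ℕ → Ω → Measure S := fun k ω => empirical (fun j => Y j ω) k
  let φ : (Z → ℝ) → S → ℝ := fun g x => ∫ z, g z ∂(κ x)
  have mφ : ∀ g : Z → ℝ, Measurable g → Measurable (φ g) := fun g hg =>
    measurable_integral_kernel κ hg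
  have bφ : ∀ g : Z → ℝ, (∀ z, |g z| ≤ 1) → ∀ x, |φ g x| ≤ 1 := fun g hg x =>
    abs_integral_le_of_abs_le hg
  have hem : ∀ g : Z → ℝ, Measurable g → (∀ z, |g z| ≤ 1) → ∀ k ω,
      ∫ z, g z ∂((em k ω).bind κ) =
        ((k : ℝ) + 1)⁻¹ * ∑ j ∈ Finset.range (k + 1), φ g (Y j ω) := fun g hg hg1 k ω => by
    rw [integral_bind_kernel κ (em k ω) hg hg1]
    exact integral_empirical _ _ (mφ g hg)
  have hQε : ∀ᵐ ω ∂μ, ∀ k, ε ≤ ∫ z, nwt w b z ∂((em k ω).bind κ) := by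
    filter_upwards [hεκ] with ω hω k
    rw [hem _ hu hu1, le_inv_mul_iff₀ (by positivity)]
    have := Finset.sum_le_sum fun j (_ : j ∈ Finset.range (k + 1)) => hω j
    simpa using this
  have havg := rpow_integral_average_sub_le (μ := μ) hw hb hwb hf hf1 hF hX hXF
    (Q := empiricalProposal κ Y)
    (fun j k hjk => measurable_empiricalProposal κ fun i hi => hYF i k (hi.trans hjk))
    (fun k ω g hg hg1 => by
      change |∫ z, g z ∂((em (k + 1) ω).bind κ) - ∫ z, g z ∂((em k ω).bind κ)| ≤ _
      rw [integral_bind_kernel κ _ hg hg1, integral_bind_kernel κ _ hg hg1]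
      exact abs_integral_empirical_succ_sub_le _ k (mφ g hg) (bφ g hg1))
    hε hε1 hQε hker hp N
  let Δ : (Z → ℝ) → ℕ → Ω → ℝ := fun g k ω =>
    ((k : ℝ) + 1)⁻¹ * (∑ j ∈ Finset.range (k + 1), φ g (Y j ω)) - ∫ x, φ g x ∂π
  have mΔ : ∀ g : Z → ℝ, Measurable g → ∀ k, Measurable (Δ g k) := fun g hg k =>
    ((Finset.measurable_fun_sum _ fun j _ => (mφ g hg).comp (hY j)).const_mul _).sub_const _
  have eΔ : ∀ g : Z → ℝ, Measurable g → (∀ z, |g z| ≤ 1) → ∀ k ω,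
      Δ g k ω = ∫ z, g z ∂((em k ω).bind κ) - ∫ z, g z ∂(π.bind κ) := fun g hg hg1 k ω => by
    rw [hem g hg hg1, integral_bind_kernel κ π hg hg1]
  have bΔ : ∀ g : Z → ℝ, Measurable g → (∀ z, |g z| ≤ 1) → ∀ k ω, |Δ g k ω| ≤ 2 :=
    fun g hg hg1 k ω => by
      rw [eΔ g hg hg1]
      refine (abs_sub _ _).trans ?_
      have h1 := abs_integral_le_of_abs_le (ν := (em k ω).bind κ) hg1
      have h2 := abs_integral_le_of_abs_le (ν := π.bind κ) hg1
      linarith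
  have hQ : ∀ k, Measurable (empiricalProposal κ Y k) := fun k =>
    measurable_empiricalProposal κ fun j _ => hY j
  have hπf : |∫ z, f z ∂π'| ≤ 1 := abs_integral_le_of_abs_le hf1
  have hT1 : ∫ z, nwt w b z ∂(π.bind κ) = T := by
    simpa using hcons (fun _ => 1) measurable_const (by simp)
  have hclose : ∀ᵐ ω ∂μ, ∀ k, |(∫ z, nwt w b z * f z ∂((em k ω).bind κ)) /
      (∫ z, nwt w b z ∂((em k ω).bind κ)) - ∫ z, f z ∂π'| ≤
      ε⁻¹ * (|Δ (fun z => nwt w b z * f z) k ω| + |Δ (nwt w b) k ω|) := by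
    filter_upwards [hQε] with ω hω k
    rw [eΔ _ hnf hnf1, eΔ _ hu hu1, hcons f hf hf1, hT1]
    have hk := hω k
    set a := ∫ z, nwt w b z * f z ∂((em k ω).bind κ)
    set d := ∫ z, nwt w b z ∂((em k ω).bind κ)
    set c := ∫ z, f z ∂π'
    have hd : 0 < d := hε.trans_le hk
    have e : a / d - c = d⁻¹ * ((a - T * c) - c * (d - T)) := by
      field_simp
      ring
    rw [e, abs_mul, abs_of_pos (inv_pos.2 hd)]
    have h1 : |(a - T * c) - c * (d - T)| ≤ |a - T * c| + |d - T| := by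
      refine (abs_sub _ _).trans (add_le_add le_rfl ?_)
      rw [abs_mul]
      exact mul_le_of_le_one_left (abs_nonneg _) hπf
    exact mul_le_mul (inv_anti₀ hε hk) h1 (abs_nonneg _) (inv_pos.2 hε).le
  have hrat : ∀ᵐ ω ∂μ, ∀ k, |(∫ z, nwt w b z * f z ∂((em k ω).bind κ)) /
      (∫ z, nwt w b z ∂((em k ω).bind κ))| ≤ 1 + ε⁻¹ * (2 + 2) := by
    filter_upwards [hclose] with ω hω k
    have h1 := abs_sub_abs_le_abs_sub ((∫ z, nwt w b z * f z ∂((em k ω).bind κ)) /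
      (∫ z, nwt w b z ∂((em k ω).bind κ))) (∫ z, f z ∂π')
    have h2 : ε⁻¹ * (|Δ (fun z => nwt w b z * f z) k ω| + |Δ (nwt w b) k ω|) ≤ ε⁻¹ * (2 + 2) :=
      mul_le_mul_of_nonneg_left (add_le_add (bΔ _ hnf hnf1 k ω) (bΔ _ hu hu1 k ω))
        (inv_pos.2 hε).le
    linarith [hω k]
  exact rpow_integral_average_sub_const_le (a := fun k ω => f (X k ω))
    (r := fun k ω => (∫ z, nwt w b z * f z ∂((em k ω).bind κ)) /
      (∫ z, nwt w b z ∂((em k ω).bind κ)))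
    (U := Δ fun z => nwt w b z * f z) (V := Δ (nwt w b))
    (fun k => hf.comp (hX k))
    (fun k => ((measurable_integral_probMeas hnf).comp (hQ k)).div
      ((measurable_integral_probMeas hu).comp (hQ k)))
    (mΔ _ hnf) (mΔ _ hu) (bΔ _ hnf hnf1) (bΔ _ hu hu1) (A := 1 + (1 + ε⁻¹ * (2 + 2)))
    (fun k => hrat.mono fun ω hω => (abs_sub _ _).trans (add_le_add (hf1 _) (hω k)))
    hε (fun k => hclose.mono fun ω hω => hω k) hp hC
    (hπ _ (mφ _ hnf) (bφ _ hnf1)) (hπ _ (mφ _ hu) (bφ _ hu1)) N havg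

end OneLevel

section Targets

open ProbabilityTheory

theorem measurable_snoc {m : ℕ} :
    Measurable fun p : (Fin m → E) × E => (Fin.snoc p.1 p.2 : Fin (m + 1) → E) := by
  refine measurable_pi_lambda _ fun i => ?_
  induction i using Fin.lastCases with
  | last => simpa using measurable_snd
  | cast i =>
    simp only [Fin.snoc_castSucc]
    exact (measurable_pi_apply i).comp measurable_fst

theorem measurable_init {m : ℕ} :
    Measurable fun x : Fin (m + 1) → E => (Fin.init x : Fin m → E) :=
  measurable_pi_lambda _ fun i => measurable_pi_apply i.castSucc

theorem measurable_wgt {γ : (n : ℕ) → (Fin n → E) → ℝ≥0∞}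
    {q : (m : ℕ) → (Fin m → E) → E → ℝ≥0∞} {m : ℕ} (hγ : Measurable (γ m))
    (hγ' : Measurable (γ (m + 1))) (hq : Measurable fun p : (Fin m → E) × E => q m p.1 p.2) :
    Measurable (wgt γ q m) :=
  hγ'.div ((hγ.comp measurable_init).mul
    (hq.comp (measurable_init.prodMk (measurable_pi_apply (Fin.last m)))))

theorem integral_nwt_eq {Z : Type*} [MeasurableSpace Z] {w : Z → ℝ≥0∞} (hw : Measurable w) {b : ℝ}
    (hwb : ∀ z, w z ≤ ENNReal.ofReal b) (ν : Measure Z) :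
    ∫ z, nwt w b z ∂ν = (∫⁻ z, w z ∂ν).toReal / b := by
  simp only [nwt]
  rw [integral_div, integral_toReal hw.aemeasurable
    (Filter.Eventually.of_forall fun z => (hwb z).trans_lt ENNReal.ofReal_lt_top)]

theorem integral_nwt_mul_eq {Z : Type*} [MeasurableSpace Z] {w : Z → ℝ≥0∞} (hw : Measurable w)
    {b : ℝ} (hwb : ∀ z, w z ≤ ENNReal.ofReal b) {ν π : Measure Z} {c : ℝ≥0∞}
    (h : ∀ F : Z → ℝ≥0∞, Measurable F → ∫⁻ z, w z * F z ∂ν = c * ∫⁻ z, F z ∂π) (g : Z → ℝ) :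
    ∫ z, nwt w b z * g z ∂ν = c.toReal / b * ∫ z, g z ∂π := by
  have e : ν.withDensity w = c • π := by
    ext s hs
    have := h (s.indicator 1) (measurable_one.indicator hs)
    rw [lintegral_indicator_one hs] at this
    rw [withDensity_apply _ hs, Measure.smul_apply, smul_eq_mul, ← this, ← lintegral_indicator hs]
    congr 1 with z
    by_cases hz : z ∈ s <;> simp [hz]
  have h1 := integral_withDensity_eq_integral_toReal_smul (μ := ν) hw
    (Filter.Eventually.of_forall fun z => (hwb z).trans_lt ENNReal.ofReal_lt_top) g
  rw [e, integral_smul_measure] at h1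
  simp only [smul_eq_mul] at h1
  rw [div_mul_eq_mul_div, h1, ← integral_div]
  congr 1 with z
  simp only [nwt]
  ring

variable {dx : Measure E} [SigmaFinite dx]

theorem lintegral_propM {q : (m : ℕ) → (Fin m → E) → E → ℝ≥0∞} {m : ℕ}
    (hq : Measurable fun p : (Fin m → E) × E => q m p.1 p.2) (μ : Measure (Fin m → E)) [SFinite μ]
    {F : (Fin (m + 1) → E) → ℝ≥0∞} (hF : Measurable F) :
    ∫⁻ z, F z ∂(propM dx q m μ) =
      ∫⁻ x, ∫⁻ y, q m x y * F (Fin.snoc x y) ∂dx ∂μ := by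
  have hFs : Measurable fun p : (Fin m → E) × E => F (Fin.snoc p.1 p.2) := hF.comp measurable_snoc
  rw [propM, lintegral_map hF measurable_snoc, lintegral_withDensity_eq_lintegral_mul _ hq hFs,
    lintegral_prod _ (hq.mul hFs).aemeasurable]
  rfl

theorem measurable_lintegral_snoc {q : (m : ℕ) → (Fin m → E) → E → ℝ≥0∞} {m : ℕ}
    (hq : Measurable fun p : (Fin m → E) × E => q m p.1 p.2)
    {F : (Fin (m + 1) → E) → ℝ≥0∞} (hF : Measurable F) :
    Measurable fun x => ∫⁻ y, q m x y * F (Fin.snoc x y) ∂dx :=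
  (hq.mul (hF.comp measurable_snoc)).lintegral_prod_right'

theorem lintegral_propM_dirac {q : (m : ℕ) → (Fin m → E) → E → ℝ≥0∞} {m : ℕ}
    (hq : Measurable fun p : (Fin m → E) × E => q m p.1 p.2) (x : Fin m → E)
    {F : (Fin (m + 1) → E) → ℝ≥0∞} (hF : Measurable F) :
    ∫⁻ z, F z ∂(propM dx q m (Measure.dirac x)) = ∫⁻ y, q m x y * F (Fin.snoc x y) ∂dx := by
  rw [lintegral_propM hq _ hF, lintegral_dirac' _ (measurable_lintegral_snoc hq hF)]

variable (dx) in
/-- The proposal kernel, drawing a new last coordinate. -/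
def propKernel {q : (m : ℕ) → (Fin m → E) → E → ℝ≥0∞} {m : ℕ}
    (hq : Measurable fun p : (Fin m → E) × E => q m p.1 p.2) :
    Kernel (Fin m → E) (Fin (m + 1) → E) :=
  ⟨fun x => propM dx q m (Measure.dirac x), by
    refine Measure.measurable_of_measurable_coe _ fun s hs => ?_
    have h1 : Measurable (s.indicator (1 : (Fin (m + 1) → E) → ℝ≥0∞)) := measurable_one.indicator hs
    simp_rw [← lintegral_indicator_one hs, lintegral_propM_dirac hq _ h1]
    exact measurable_lintegral_snoc hq h1⟩

theorem isMarkovKernel_propKernel {q : (m : ℕ) → (Fin m → E) → E → ℝ≥0∞} {m : ℕ}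
    (hq : Measurable fun p : (Fin m → E) × E => q m p.1 p.2)
    (hqdens : ∀ x, ∫⁻ y, q m x y ∂dx = 1) : IsMarkovKernel (propKernel dx hq) := by
  refine ⟨fun x => ⟨?_⟩⟩
  change propM dx q m (Measure.dirac x) Set.univ = 1
  rw [← lintegral_one, lintegral_propM_dirac hq _ measurable_const]
  simpa using hqdens x

theorem bind_propKernel {q : (m : ℕ) → (Fin m → E) → E → ℝ≥0∞} {m : ℕ}
    (hq : Measurable fun p : (Fin m → E) × E => q m p.1 p.2) (μ : Measure (Fin m → E))
    [SFinite μ] : μ.bind (propKernel dx hq) = propM dx q m μ := by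
  ext s hs
  have h1 : Measurable (s.indicator (1 : (Fin (m + 1) → E) → ℝ≥0∞)) := measurable_one.indicator hs
  rw [Measure.bind_apply hs (Kernel.aemeasurable _), ← lintegral_indicator_one hs,
    lintegral_propM hq μ h1]
  refine lintegral_congr fun x => ?_
  rw [← lintegral_propM_dirac hq x h1, lintegral_indicator_one hs]
  rfl

theorem lintegral_pi_snoc {m : ℕ} {F : (Fin (m + 1) → E) → ℝ≥0∞} (hF : Measurable F) :
    ∫⁻ z, F z ∂(Measure.pi fun _ : Fin (m + 1) => dx) =
      ∫⁻ x, ∫⁻ y, F (Fin.snoc x y) ∂dx ∂(Measure.pi fun _ : Fin m => dx) := by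
  have h := (measurePreserving_piFinSuccAbove (fun _ : Fin (m + 1) => dx) (Fin.last m)).symm
  rw [← h.lintegral_comp hF]
  have hF' : Measurable fun p : E × (Fin m → E) =>
      F ((MeasurableEquiv.piFinSuccAbove (fun _ => E) (Fin.last m)).symm p) :=
    hF.comp (MeasurableEquiv.measurable _)
  rw [lintegral_prod_symm _ hF'.aemeasurable]
  refine lintegral_congr fun x => lintegral_congr fun y => ?_
  congr 1
  exact Fin.insertNth_last' y x

variable {γ : (n : ℕ) → (Fin n → E) → ℝ≥0∞} {Z : ℕ → ℝ≥0∞}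

theorem lintegral_tgt {n : ℕ} (hγ : Measurable (γ n)) {F : (Fin n → E) → ℝ≥0∞}
    (hF : Measurable F) :
    ∫⁻ x, F x ∂(tgt dx γ Z n) = ∫⁻ x, γ n x / Z n * F x ∂(Measure.pi fun _ : Fin n => dx) := by
  rw [tgt, lintegral_withDensity_eq_lintegral_mul _ (hγ.div_const _) hF]
  rfl

theorem isProbabilityMeasure_tgt {n : ℕ} (hγ : Measurable (γ n))
    (hZ : Z n = ∫⁻ x, γ n x ∂(Measure.pi fun _ : Fin n => dx)) (hZ0 : Z n ≠ 0) (hZt : Z n ≠ ⊤) :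
    IsProbabilityMeasure (tgt dx γ Z n) := by
  refine ⟨?_⟩
  rw [← lintegral_one, lintegral_tgt hγ measurable_const]
  simp_rw [mul_one, div_eq_mul_inv]
  rw [lintegral_mul_const _ hγ, ← hZ, ENNReal.mul_inv_cancel hZ0 hZt]

section Weights

variable {q : (m : ℕ) → (Fin m → E) → E → ℝ≥0∞} {m : ℕ}
  (hqpos : ∀ x y, q m x y ≠ 0) (hqfin : ∀ x y, q m x y ≠ ⊤)
  (hγfin : ∀ x, γ m x ≠ ⊤)

omit [MeasurableSpace E]

theorem wgt_eq_zero {x : Fin (m + 1) → E} (hx : γ (m + 1) x = 0) : wgt γ q m x = 0 := by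
  simp [wgt, hx]

theorem wgt_eq_top {x : Fin (m + 1) → E} (hx : γ (m + 1) x ≠ 0) (hx' : γ m (Fin.init x) = 0) :
    wgt γ q m x = ⊤ := by
  simp [wgt, hx', ENNReal.div_zero hx]

include hqfin hγfin in
theorem wgt_ne_zero {x : Fin (m + 1) → E} (hx : γ (m + 1) x ≠ 0) : wgt γ q m x ≠ 0 :=
  ENNReal.div_ne_zero.2 ⟨hx, ENNReal.mul_ne_top (hγfin _) (hqfin _ _)⟩

include hqpos hqfin hγfin in
theorem mul_wgt_snoc (hsupp : ∀ x, γ (m + 1) x ≠ 0 → γ m (Fin.init x) ≠ 0) (x : Fin m → E)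
    (y : E) : γ m x * (q m x y * wgt γ q m (Fin.snoc x y)) = γ (m + 1) (Fin.snoc x y) := by
  by_cases h : γ m x = 0
  · have : γ (m + 1) (Fin.snoc x y) = 0 := by
      by_contra h'
      exact hsupp _ h' (by simpa using h)
    rw [h, this, zero_mul]
  · rw [← mul_assoc, wgt]
    simp only [Fin.init_snoc, Fin.snoc_last]
    exact ENNReal.mul_div_cancel (mul_ne_zero h (hqpos x y))
      (ENNReal.mul_ne_top (hγfin x) (hqfin x y))

end Weights

variable {q : (m : ℕ) → (Fin m → E) → E → ℝ≥0∞} {m : ℕ}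
  (hqpos : ∀ x y, q m x y ≠ 0) (hqfin : ∀ x y, q m x y ≠ ⊤)
  (hγfin : ∀ x, γ m x ≠ ⊤) (hq : Measurable fun p : (Fin m → E) × E => q m p.1 p.2)
  (hγ : Measurable (γ m)) (hγ' : Measurable (γ (m + 1)))
  (hsupp : ∀ x, γ (m + 1) x ≠ 0 → γ m (Fin.init x) ≠ 0)

include hqpos hqfin hγfin hq hγ hγ' hsupp

theorem lintegral_wgt_mul_propM_tgt [SFinite (tgt dx γ Z m)] (hZ0 : Z (m + 1) ≠ 0)
    (hZt : Z (m + 1) ≠ ⊤) {F : (Fin (m + 1) → E) → ℝ≥0∞} (hF : Measurable F) :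
    ∫⁻ z, wgt γ q m z * F z ∂(propM dx q m (tgt dx γ Z m)) =
      Z (m + 1) / Z m * ∫⁻ z, F z ∂(tgt dx γ Z (m + 1)) := by
  have hwF : Measurable fun z => wgt γ q m z * F z := (measurable_wgt hγ hγ' hq).mul hF
  have hF' : Measurable fun z => γ (m + 1) z / Z (m + 1) * F z := (hγ'.div_const _).mul hF
  rw [lintegral_propM hq _ hwF, lintegral_tgt hγ (measurable_lintegral_snoc hq hwF),
    lintegral_tgt hγ' hF, ← lintegral_const_mul _ hF', lintegral_pi_snoc (hF'.const_mul _)]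
  refine lintegral_congr fun x => ?_
  have hx : Measurable fun y => q m x y * (wgt γ q m (Fin.snoc x y) * F (Fin.snoc x y)) :=
    (hq.mul (hwF.comp measurable_snoc)).comp measurable_prodMk_left
  rw [← lintegral_const_mul _ hx]
  refine lintegral_congr fun y => ?_
  rw [← mul_wgt_snoc hqpos hqfin hγfin hsupp x y, div_eq_mul_inv, div_eq_mul_inv, div_eq_mul_inv]
  calc γ m x * (Z m)⁻¹ * (q m x y * (wgt γ q m (Fin.snoc x y) * F (Fin.snoc x y)))
      = (Z m)⁻¹ * (γ m x * (q m x y * wgt γ q m (Fin.snoc x y)) * F (Fin.snoc x y)) := by ring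
    _ = Z (m + 1) * (Z (m + 1))⁻¹ *
        ((Z m)⁻¹ * (γ m x * (q m x y * wgt γ q m (Fin.snoc x y)) * F (Fin.snoc x y))) := by
      rw [ENNReal.mul_inv_cancel hZ0 hZt, one_mul]
    _ = _ := by ring

theorem lintegral_wgt_propM_dirac (hZ0 : Z (m + 1) ≠ 0) (hZt : Z (m + 1) ≠ ⊤) (hZm0 : Z m ≠ 0)
    (hZmt : Z m ≠ ⊤) {x : Fin m → E} (hx : γ m x ≠ 0) :
    ∫⁻ z, wgt γ q m z ∂(propM dx q m (Measure.dirac x)) =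
      ratio dx γ Z m x * (Z (m + 1) / Z m) := by
  rw [lintegral_propM_dirac hq x (measurable_wgt hγ hγ' hq)]
  have hm : Measurable fun y => q m x y * wgt γ q m (Fin.snoc x y) :=
    (hq.mul ((measurable_wgt hγ hγ' hq).comp measurable_snoc)).comp measurable_prodMk_left
  set I := ∫⁻ y, q m x y * wgt γ q m (Fin.snoc x y) ∂dx with hI
  have h1 : ∫⁻ y, γ (m + 1) (Fin.snoc x y) ∂dx = γ m x * I := by
    simp_rw [← mul_wgt_snoc hqpos hqfin hγfin hsupp x]
    rw [hI, lintegral_const_mul _ hm]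
  rw [ratio, marg, h1, div_eq_mul_inv, div_eq_mul_inv, div_eq_mul_inv, div_eq_mul_inv,
    ENNReal.mul_inv (Or.inl hx) (Or.inl (hγfin x)), inv_inv]
  calc I = (γ m x * (γ m x)⁻¹) * (Z (m + 1) * (Z (m + 1))⁻¹) * (Z m * (Z m)⁻¹) * I := by
        rw [ENNReal.mul_inv_cancel hx (hγfin x), ENNReal.mul_inv_cancel hZ0 hZt,
          ENNReal.mul_inv_cancel hZm0 hZmt]
        simp
    _ = _ := by ring

end Targets

section FirstLevel

variable {dx : Measure E} [SigmaFinite dx] {γ : (n : ℕ) → (Fin n → E) → ℝ≥0∞} {Z : ℕ → ℝ≥0∞}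
  {q1 : E → ℝ≥0∞}

omit [SigmaFinite dx] in
theorem lintegral_prop1 (hq1 : Measurable q1) {F : (Fin 1 → E) → ℝ≥0∞} (hF : Measurable F) :
    ∫⁻ z, F z ∂(prop1 dx q1) = ∫⁻ y, q1 y * F (fun _ => y) ∂dx := by
  have hc : Measurable fun y : E => (fun _ : Fin 1 => y) :=
    measurable_pi_lambda _ fun _ => measurable_id
  have hFc : Measurable fun y : E => F fun _ => y := hF.comp hc
  rw [prop1, lintegral_map hF hc, lintegral_withDensity_eq_lintegral_mul _ hq1 hFc]
  rfl

omit [SigmaFinite dx] in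
theorem isProbabilityMeasure_prop1 (hq1 : Measurable q1) (h : ∫⁻ y, q1 y ∂dx = 1) :
    IsProbabilityMeasure (prop1 dx q1) := by
  refine ⟨?_⟩
  rw [← lintegral_one, lintegral_prop1 hq1 measurable_const]
  simpa using h

theorem measurable_wgt1 (hγ : Measurable (γ 1)) (hq1 : Measurable q1) : Measurable (wgt1 γ q1) :=
  hγ.div (hq1.comp (measurable_pi_apply 0))

theorem lintegral_wgt1_mul_prop1 (hq1 : Measurable q1) (hq1pos : ∀ y, q1 y ≠ 0)
    (hq1fin : ∀ y, q1 y ≠ ⊤) (hγ : Measurable (γ 1)) (hZ0 : Z 1 ≠ 0) (hZt : Z 1 ≠ ⊤)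
    {F : (Fin 1 → E) → ℝ≥0∞} (hF : Measurable F) :
    ∫⁻ z, wgt1 γ q1 z * F z ∂(prop1 dx q1) = Z 1 * ∫⁻ z, F z ∂(tgt dx γ Z 1) := by
  have hwF : Measurable fun z => wgt1 γ q1 z * F z := (measurable_wgt1 hγ hq1).mul hF
  have hF' : Measurable fun z => γ 1 z / Z 1 * F z := (hγ.div_const _).mul hF
  rw [lintegral_prop1 hq1 hwF, lintegral_tgt hγ hF, ← lintegral_const_mul _ hF']
  have h : MeasurePreserving (MeasurableEquiv.funUnique (Fin 1) E).symm dx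
      (Measure.pi fun _ => dx) := by
    convert (measurePreserving_funUnique dx (Fin 1)).symm
  rw [← h.lintegral_comp (hF'.const_mul (Z 1))]
  refine lintegral_congr fun y => ?_
  change q1 y * (γ 1 (fun _ => y) / q1 y * F fun _ => y) =
    Z 1 * (γ 1 (fun _ => y) / Z 1 * F fun _ => y)
  rw [← mul_assoc, ← mul_assoc, ENNReal.mul_div_cancel (hq1pos y) (hq1fin y),
    ENNReal.mul_div_cancel hZ0 hZt]

end FirstLevel

section Past

variable {Ω : Type*} [mΩ : MeasurableSpace Ω] {P : ℕ} {X : (n : ℕ) → ℕ → Ω → (Fin n → E)}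

theorem past_le (hX : ∀ k i, 1 ≤ k → k ≤ P → Measurable (X k i)) {n : ℕ} (hn : n ≤ P) (i : ℕ) :
    past P X n i ≤ mΩ := by
  refine iSup_le fun k => iSup_le fun j => iSup_le fun h => Measurable.comap_le (hX k j ?_ ?_)
  · omega
  · omega

omit mΩ in
theorem measurable_past {n i k j : ℕ}
    (h : (1 ≤ k ∧ k ≤ P ∧ j < i) ∨ (1 ≤ k ∧ k < n ∧ j = i)) : Measurable[past P X n i] (X k j) :=
  Measurable.of_comap_le (le_iSup_of_le k (le_iSup_of_le j (le_iSup_of_le h le_rfl)))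

end Past

section Model

/-- The standing assumptions on the sequence of targets and proposals. -/
structure IsModel (dx : Measure E) [SigmaFinite dx] (P : ℕ) (γ : (n : ℕ) → (Fin n → E) → ℝ≥0∞)
    (Z : ℕ → ℝ≥0∞) (q1 : E → ℝ≥0∞) (q : (m : ℕ) → (Fin m → E) → E → ℝ≥0∞) (B : ℕ → ℝ≥0∞) :
    Prop where
  measurable_density : ∀ n, 1 ≤ n → n ≤ P → Measurable (γ n)
  density_ne_top : ∀ n, 1 ≤ n → n ≤ P → ∀ x, γ n x ≠ ⊤
  normalizer_eq : ∀ n, 1 ≤ n → n ≤ P → Z n = ∫⁻ x, γ n x ∂(Measure.pi fun _ : Fin n => dx)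
  normalizer_pos : ∀ n, 1 ≤ n → n ≤ P → 0 < Z n
  normalizer_ne_top : ∀ n, 1 ≤ n → n ≤ P → Z n ≠ ⊤
  measurable_prop1 : Measurable q1
  prop1_pos : ∀ y, 0 < q1 y
  prop1_ne_top : ∀ y, q1 y ≠ ⊤
  lintegral_prop1 : ∫⁻ y, q1 y ∂dx = 1
  measurable_prop : ∀ m, 1 ≤ m → m + 1 ≤ P → Measurable fun p : (Fin m → E) × E => q m p.1 p.2
  prop_pos : ∀ m x y, 0 < q m x y
  prop_ne_top : ∀ m x y, q m x y ≠ ⊤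
  lintegral_prop : ∀ m, 1 ≤ m → m + 1 ≤ P → ∀ x, ∫⁻ y, q m x y ∂dx = 1
  bound_ne_top : ∀ n, 1 ≤ n → n ≤ P → B n ≠ ⊤
  weight1_le : ∀ x : Fin 1 → E, 0 < γ 1 x / Z 1 → wgt1 γ q1 x ≤ B 1
  weight_le : ∀ m, 1 ≤ m → m + 1 ≤ P → ∀ x : Fin (m + 1) → E,
    0 < γ (m + 1) x / Z (m + 1) → wgt γ q m x ≤ B (m + 1)
  ratio_ge : ∀ m, 1 ≤ m → m + 1 ≤ P → ∃ δ : ℝ≥0∞, 0 < δ ∧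
    ∀ x : Fin m → E, 0 < γ m x / Z m → δ ≤ ratio dx γ Z m x

/-- The sequentially interacting chains, started from `x0`. -/
structure IsInteractingChain {Ω : Type*} [MeasurableSpace Ω] (μ : Measure Ω) (dx : Measure E)
    (P : ℕ) (γ : (n : ℕ) → (Fin n → E) → ℝ≥0∞) (Z : ℕ → ℝ≥0∞) (q1 : E → ℝ≥0∞)
    (q : (m : ℕ) → (Fin m → E) → E → ℝ≥0∞) (X : (n : ℕ) → ℕ → Ω → (Fin n → E))
    (x0 : (n : ℕ) → Fin n → E) : Prop where
  measurable : ∀ k i, 1 ≤ k → k ≤ P → Measurable (X k i)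
  initial_pos : ∀ k, 1 ≤ k → k ≤ P → 0 < γ k (x0 k) / Z k
  initial_eq : ∀ k, 1 ≤ k → k ≤ P → ∀ ω, X k 0 ω = x0 k
  condExp_first : ∀ i, 1 ≤ i → ∀ g : (Fin 1 → E) → ℝ, Measurable g → (∀ z, |g z| ≤ 1) →
    (μ[(fun ω => g (X 1 i ω))|past P X 1 i]) =ᵐ[μ]
      fun ω => ∫ z, g z ∂(ker1 dx γ q1 (X 1 (i - 1) ω))
  condExp_succ : ∀ m, 1 ≤ m → m + 1 ≤ P → ∀ i, 1 ≤ i → ∀ g : (Fin (m + 1) → E) → ℝ,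
    Measurable g → (∀ z, |g z| ≤ 1) →
    (μ[(fun ω => g (X (m + 1) i ω))|past P X (m + 1) i]) =ᵐ[μ]
      fun ω => ∫ z, g z ∂(kerM dx γ q m (emp X m i ω) (X (m + 1) (i - 1) ω))

variable {dx : Measure E} [SigmaFinite dx] {P : ℕ} {γ : (n : ℕ) → (Fin n → E) → ℝ≥0∞}
  {Z : ℕ → ℝ≥0∞} {q1 : E → ℝ≥0∞} {q : (m : ℕ) → (Fin m → E) → E → ℝ≥0∞} {B : ℕ → ℝ≥0∞}

theorem le_ofReal_toReal_add_one {a c : ℝ≥0∞} (h : a ≤ c) (hc : c ≠ ⊤) :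
    a ≤ ENNReal.ofReal (c.toReal + 1) :=
  h.trans ((ENNReal.ofReal_toReal hc).symm.le.trans (ENNReal.ofReal_le_ofReal (by linarith)))

namespace IsModel

variable (hM : IsModel dx P γ Z q1 q B)
include hM

theorem isProbabilityMeasure_tgt {n : ℕ} (h1 : 1 ≤ n) (hn : n ≤ P) :
    IsProbabilityMeasure (tgt dx γ Z n) :=
  Paper.isProbabilityMeasure_tgt (hM.measurable_density n h1 hn) (hM.normalizer_eq n h1 hn)
    (hM.normalizer_pos n h1 hn).ne' (hM.normalizer_ne_top n h1 hn)

theorem density_div_pos {n : ℕ} (h1 : 1 ≤ n) (hn : n ≤ P) {x : Fin n → E} (hx : γ n x ≠ 0) :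
    0 < γ n x / Z n :=
  ENNReal.div_pos hx (hM.normalizer_ne_top n h1 hn)

theorem wgt1_le (hP : 1 ≤ P) (x : Fin 1 → E) :
    wgt1 γ q1 x ≤ ENNReal.ofReal ((B 1).toReal + 1) := by
  by_cases hx : γ 1 x = 0
  · simp [wgt1, hx]
  · exact le_ofReal_toReal_add_one (hM.weight1_le x (hM.density_div_pos le_rfl hP hx))
      (hM.bound_ne_top 1 le_rfl hP)

variable {m : ℕ} (h1 : 1 ≤ m) (hm : m + 1 ≤ P)
include h1 hm

theorem wgt_le (x : Fin (m + 1) → E) :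
    wgt γ q m x ≤ ENNReal.ofReal ((B (m + 1)).toReal + 1) := by
  by_cases hx : γ (m + 1) x = 0
  · simp [wgt, hx]
  · exact le_ofReal_toReal_add_one
      (hM.weight_le m h1 hm x (hM.density_div_pos (by omega) hm hx))
      (hM.bound_ne_top (m + 1) (by omega) hm)

theorem density_init_ne_zero (x : Fin (m + 1) → E) (hx : γ (m + 1) x ≠ 0) :
    γ m (Fin.init x) ≠ 0 := fun h => by
  have := hM.wgt_le h1 hm x
  rw [wgt_eq_top hx h] at this
  exact ENNReal.ofReal_ne_top (top_le_iff.1 this)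

theorem measurable_wgt : Measurable (wgt γ q m) :=
  Paper.measurable_wgt (hM.measurable_density m h1 (by omega))
    (hM.measurable_density (m + 1) (by omega) hm) (hM.measurable_prop m h1 hm)

omit h1 hm

variable {Ω : Type*} [MeasurableSpace Ω] {μ : Measure Ω} [IsProbabilityMeasure μ]
  {X : (n : ℕ) → ℕ → Ω → (Fin n → E)} {x0 : (n : ℕ) → Fin n → E}
  (hX : IsInteractingChain μ dx P γ Z q1 q X x0)
include hX

omit hM [IsProbabilityMeasure μ] in
theorem condExp_succ_eq_bind {m : ℕ} (h1 : 1 ≤ m) (hm : m + 1 ≤ P)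
    (hq : Measurable fun p : (Fin m → E) × E => q m p.1 p.2) (k : ℕ)
    (g : (Fin (m + 1) → E) → ℝ) (hg : Measurable g) (hg1 : ∀ z, |g z| ≤ 1) :
    μ[fun ω => g (X (m + 1) (k + 1) ω)|past P X (m + 1) (k + 1)] =ᵐ[μ]
      fun ω => ∫ z, g z ∂(mh (wgt γ q m)
        ((empirical (fun j => X m j ω) (k + 1)).bind (propKernel dx hq)) (X (m + 1) k ω)) := by
  simp_rw [bind_propKernel hq]
  exact hX.condExp_succ m h1 hm (k + 1) (by omega) g hg hg1

/-- Each chain almost surely stays in the support of its target. -/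
theorem ae_density_ne_zero {n : ℕ} (h1 : 1 ≤ n) (hn : n ≤ P) :
    ∀ᵐ ω ∂μ, ∀ k, γ n (X n k ω) ≠ 0 := by
  have h0 : ∀ ω, γ n (X n 0 ω) ≠ 0 := fun ω h => by
    have := hX.initial_pos n h1 hn
    rw [← hX.initial_eq n h1 hn ω, h, ENNReal.zero_div] at this
    exact lt_irrefl _ this
  have hF : ∀ k, past P X n k ≤ _ := past_le hX.measurable hn
  have hXm : ∀ k, Measurable (X n k) := fun k => hX.measurable n k h1 hn
  obtain rfl | ⟨m, hm1, rfl⟩ : n = 1 ∨ ∃ m, 1 ≤ m ∧ n = m + 1 := by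
    rcases n with _ | _ | m
    · omega
    · exact Or.inl rfl
    · exact Or.inr ⟨m + 1, by omega, rfl⟩
  · have hp := isProbabilityMeasure_prop1 hM.measurable_prop1 hM.lintegral_prop1
    have := ae_weight_ne_zero (μ := μ)
      (measurable_wgt1 (hM.measurable_density 1 le_rfl hn) hM.measurable_prop1) hF hXm
      (Q := fun _ _ => ⟨prop1 dx q1, hp⟩)
      (fun k g hg hg1 => hX.condExp_first (k + 1) (by omega) g hg hg1)
      (fun ω => ENNReal.div_ne_zero.2 ⟨h0 ω, hM.prop1_ne_top _⟩)
    filter_upwards [this] with ω hω k h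
    exact hω k (by simp [wgt1, h])
  · have hq := hM.measurable_prop m hm1 hn
    have := isMarkovKernel_propKernel hq (hM.lintegral_prop m hm1 hn)
    have := ae_weight_ne_zero (μ := μ) (hM.measurable_wgt hm1 hn) hF hXm
      (Q := empiricalProposal (propKernel dx hq) (X m))
      (condExp_succ_eq_bind hX hm1 hn hq)
      (fun ω => wgt_ne_zero (hM.prop_ne_top m) (hM.density_ne_top m hm1 (by omega)) (h0 ω))
    filter_upwards [this] with ω hω k h
    exact hω k (wgt_eq_zero h)

end IsModel

variable (dx P γ Z q1 q) in
/-- The averages of the `n`-th chain converge in every `L^p` at rate `c * p / √(i + 1)`. -/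
def AverageBound.{u} (n : ℕ) (c : ℝ) : Prop :=
  ∀ p : ℝ, 1 ≤ p → ∀ (Ω : Type u) [MeasurableSpace Ω] (μ : Measure Ω) [IsProbabilityMeasure μ]
    (X : (n : ℕ) → ℕ → Ω → (Fin n → E)) (x0 : (n : ℕ) → Fin n → E),
    IsInteractingChain μ dx P γ Z q1 q X x0 →
    ∀ f : (Fin n → E) → ℝ, Measurable f → (∀ z, |f z| ≤ 1) → ∀ i : ℕ,
      (∫ ω, |((i : ℝ) + 1)⁻¹ * (∑ k ∈ Finset.range (i + 1), f (X n k ω)) -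
        ∫ z, f z ∂(tgt dx γ Z n)| ^ p ∂μ) ^ (1 / p) ≤ c * p / √((i : ℝ) + 1)

namespace IsModel

variable (hM : IsModel dx P γ Z q1 q B)
include hM

theorem exists_averageBound_one (hP : 1 ≤ P) :
    ∃ c : ℝ, 0 ≤ c ∧ AverageBound dx P γ Z q1 q 1 c := by
  set b := (B 1).toReal + 1 with hb
  have hb0 : 0 < b := by positivity
  have hZ0 := hM.normalizer_pos 1 le_rfl hP
  have hZt := hM.normalizer_ne_top 1 le_rfl hP
  have hγ := hM.measurable_density 1 le_rfl hP
  have hw := measurable_wgt1 hγ hM.measurable_prop1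
  have hT : 0 < (Z 1).toReal / b := div_pos (ENNReal.toReal_pos hZ0.ne' hZt) hb0
  have hp1 := isProbabilityMeasure_prop1 hM.measurable_prop1 hM.lintegral_prop1
  have ht := hM.isProbabilityMeasure_tgt le_rfl hP
  have hcons := integral_nwt_mul_eq hw (hM.wgt1_le hP) fun F hF =>
    lintegral_wgt1_mul_prop1 (dx := dx) hM.measurable_prop1 (fun y => (hM.prop1_pos y).ne')
      hM.prop1_ne_top hγ hZ0.ne' hZt hF
  have hmass : ∫ z, nwt (wgt1 γ q1) b z ∂(prop1 dx q1) = (Z 1).toReal / b := by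
    simpa using hcons fun _ => 1
  refine ⟨28 / min ((Z 1).toReal / b) 1 ^ 2, by positivity, ?_⟩
  intro p hp Ω _ μ _ X x0 hX f hf hf1 i
  exact rpow_integral_average_le_of_fixed_proposal hw hb0 (hM.wgt1_le hP) hf hf1
    (past_le hX.measurable hP) (fun k => hX.measurable 1 k le_rfl hP)
    (fun j k hjk => measurable_past (Or.inl ⟨le_rfl, hP, hjk⟩)) (lt_min hT one_pos)
    (min_le_right _ _) hT hp (fun g _ _ => hcons g) (hmass.symm ▸ min_le_left _ _)
    (fun k g hg hg1 => hX.condExp_first (k + 1) (by omega) g hg hg1) i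

theorem exists_averageBound_succ.{u} {m : ℕ} (h1 : 1 ≤ m) (hm : m + 1 ≤ P) {c : ℝ} (hc : 0 ≤ c)
    (h : AverageBound.{_, u} dx P γ Z q1 q m c) :
    ∃ c' : ℝ, 0 ≤ c' ∧ AverageBound.{_, u} dx P γ Z q1 q (m + 1) c' := by
  have hmP : m ≤ P := by omega
  have h1' : 1 ≤ m + 1 := by omega
  set b := (B (m + 1)).toReal + 1 with hb
  have hb0 : 0 < b := by positivity
  have hZ0 := hM.normalizer_pos (m + 1) h1' hm
  have hZt := hM.normalizer_ne_top (m + 1) h1' hm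
  have hZm0 := hM.normalizer_pos m h1 hmP
  have hZmt := hM.normalizer_ne_top m h1 hmP
  have hγ := hM.measurable_density m h1 hmP
  have hγ' := hM.measurable_density (m + 1) h1' hm
  have hq := hM.measurable_prop m h1 hm
  have hqpos : ∀ x y, q m x y ≠ 0 := fun x y => (hM.prop_pos m x y).ne'
  have hγfin := hM.density_ne_top m h1 hmP
  have hsupp := hM.density_init_ne_zero h1 hm
  have hw := hM.measurable_wgt h1 hm
  have hwb := hM.wgt_le h1 hm
  have hκ := isMarkovKernel_propKernel hq (hM.lintegral_prop m h1 hm)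
  have ht := hM.isProbabilityMeasure_tgt h1 hmP
  have ht' := hM.isProbabilityMeasure_tgt h1' hm
  obtain ⟨δ, hδ0, hδ⟩ := hM.ratio_ge m h1 hm
  have hcons := integral_nwt_mul_eq hw hwb fun F hF =>
    lintegral_wgt_mul_propM_tgt (dx := dx) hqpos (hM.prop_ne_top m) hγfin hq hγ hγ' hsupp
      hZ0.ne' hZt hF
  rw [← bind_propKernel hq] at hcons
  set a := min δ 1 * (Z (m + 1) / Z m) with ha
  have ha0 : a ≠ 0 :=
    mul_ne_zero (lt_min hδ0 one_pos).ne' (ENNReal.div_pos hZ0.ne' hZmt).ne'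
  have hat : a ≠ ⊤ := ENNReal.mul_ne_top (ne_top_of_le_ne_top ENNReal.one_ne_top (min_le_right _ _))
    (ENNReal.div_ne_top hZt hZm0.ne')
  have hε : 0 < min (a.toReal / b) 1 :=
    lt_min (div_pos (ENNReal.toReal_pos ha0 hat) hb0) one_pos
  have hεκ : ∀ x, γ m x ≠ 0 →
      min (a.toReal / b) 1 ≤ ∫ z, nwt (wgt γ q m) b z ∂(propKernel dx hq x) := fun x hx => by
    have hI : ∫⁻ z, wgt γ q m z ∂(propKernel dx hq x) = ratio dx γ Z m x * (Z (m + 1) / Z m) :=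
      lintegral_wgt_propM_dirac hqpos (hM.prop_ne_top m) hγfin hq hγ hγ' hsupp hZ0.ne' hZt
        hZm0.ne' hZmt hx
    have hIt : ∫⁻ z, wgt γ q m z ∂(propKernel dx hq x) ≠ ⊤ :=
      ne_top_of_le_ne_top ENNReal.ofReal_ne_top
        ((lintegral_mono hwb).trans_eq (by rw [lintegral_const, measure_univ, mul_one]))
    rw [integral_nwt_eq hw hwb]
    refine (min_le_left _ _).trans (div_le_div_of_nonneg_right (ENNReal.toReal_mono hIt ?_) hb0.le)
    rw [hI]
    exact mul_le_mul_left ((min_le_left _ _).trans (hδ x (hM.density_div_pos h1 hmP hx))) _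
  set ε := min (a.toReal / b) 1
  refine ⟨28 / ε ^ 2 + 4 / ε * c, by positivity, ?_⟩
  intro p hp Ω _ μ _ X x0 hX f hf hf1 i
  have hp0 : 0 ≤ p := by linarith
  refine (rpow_integral_average_le_of_empirical hw hb0 hwb hf hf1 (past_le hX.measurable hm)
    (fun k => hX.measurable (m + 1) k h1' hm)
    (fun j k hjk => measurable_past (Or.inl ⟨h1', hm, hjk⟩)) hε (min_le_right _ _) hp
    (fun k => hX.measurable m k h1 hmP)
    (fun j k hjk => measurable_past (by omega)) (fun g _ _ => hcons g)
    ((hM.ae_density_ne_zero hX h1 hmP).mono fun ω hω j => hεκ _ (hω j))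
    (condExp_succ_eq_bind hX h1 hm hq) (mul_nonneg hc hp0)
    (fun g hg hg1 k => h p hp Ω μ X x0 hX g hg hg1 k) i).trans_eq ?_
  ring

theorem exists_averageBound {n : ℕ} (h1 : 1 ≤ n) (hn : n ≤ P) :
    ∃ c : ℝ, 0 ≤ c ∧ AverageBound dx P γ Z q1 q n c := by
  induction n, h1 using Nat.le_induction with
  | base => exact hM.exists_averageBound_one hn
  | succ m hm ih =>
    obtain ⟨c, hc, h⟩ := ih (by omega)
    exact hM.exists_averageBound_succ hm hn hc h

end IsModel
end Model

theorem statement17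
    (dx : Measure E) [SigmaFinite dx] (P : ℕ) (hP : 1 ≤ P)
    (γ : (n : ℕ) → (Fin n → E) → ℝ≥0∞)
    (hγ : ∀ n, 1 ≤ n → n ≤ P → Measurable (γ n))
    (hγfin : ∀ n, 1 ≤ n → n ≤ P → ∀ x, γ n x ≠ ⊤)
    (Z : ℕ → ℝ≥0∞)
    (hZ : ∀ n, 1 ≤ n → n ≤ P → Z n = ∫⁻ x, γ n x ∂(Measure.pi fun _ : Fin n => dx))
    (hZ0 : ∀ n, 1 ≤ n → n ≤ P → 0 < Z n) (hZt : ∀ n, 1 ≤ n → n ≤ P → Z n ≠ ⊤)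
    (q1 : E → ℝ≥0∞) (hq1 : Measurable q1) (hq1pos : ∀ y, 0 < q1 y)
    (hq1fin : ∀ y, q1 y ≠ ⊤) (hq1dens : ∫⁻ y, q1 y ∂dx = 1)
    (q : (m : ℕ) → (Fin m → E) → E → ℝ≥0∞)
    (hq : ∀ m, 1 ≤ m → m + 1 ≤ P → Measurable fun p : (Fin m → E) × E => q m p.1 p.2)
    (hqpos : ∀ m x y, 0 < q m x y) (hqfin : ∀ m x y, q m x y ≠ ⊤)
    (hqdens : ∀ m, 1 ≤ m → m + 1 ≤ P → ∀ x, ∫⁻ y, q m x y ∂dx = 1)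
    (B : ℕ → ℝ≥0∞) (hBt : ∀ n, 1 ≤ n → n ≤ P → B n ≠ ⊤)
    (hA11 : ∀ x : Fin 1 → E, 0 < γ 1 x / Z 1 → wgt1 γ q1 x ≤ B 1)
    (hA1 : ∀ m, 1 ≤ m → m + 1 ≤ P → ∀ x : Fin (m + 1) → E,
      0 < γ (m + 1) x / Z (m + 1) → wgt γ q m x ≤ B (m + 1))
    (hδ : ∀ m, 1 ≤ m → m + 1 ≤ P → ∃ δ : ℝ≥0∞, 0 < δ ∧
      ∀ x : Fin m → E, 0 < γ m x / Z m → δ ≤ ratio dx γ Z m x)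
    :
    ∃ C1 : ℕ → ℝ, ∃ C2 : ℝ → ℝ,
      ∀ n, 1 ≤ n → n ≤ P → ∀ p : ℝ, 1 ≤ p →
      ∀ (Ω : Type*) [MeasurableSpace Ω] (μ : Measure Ω) [IsProbabilityMeasure μ]
        (X : (n : ℕ) → ℕ → Ω → (Fin n → E)) (x0 : (n : ℕ) → Fin n → E),
        (∀ k i, 1 ≤ k → k ≤ P → Measurable (X k i)) →
        (∀ k, 1 ≤ k → k ≤ P → 0 < γ k (x0 k) / Z k) →
        (∀ k, 1 ≤ k → k ≤ P → ∀ ω, X k 0 ω = x0 k) →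
        (∀ i, 1 ≤ i → ∀ g : (Fin 1 → E) → ℝ, Measurable g → (∀ z, |g z| ≤ 1) →
          (μ[(fun ω => g (X 1 i ω))|past P X 1 i]) =ᵐ[μ]
            fun ω => ∫ z, g z ∂(ker1 dx γ q1 (X 1 (i - 1) ω))) →
        (∀ m, 1 ≤ m → m + 1 ≤ P → ∀ i, 1 ≤ i → ∀ g : (Fin (m + 1) → E) → ℝ,
          Measurable g → (∀ z, |g z| ≤ 1) →
          (μ[(fun ω => g (X (m + 1) i ω))|past P X (m + 1) i]) =ᵐ[μ]
            fun ω => ∫ z, g z ∂(kerM dx γ q m (emp X m i ω) (X (m + 1) (i - 1) ω))) →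
        ∀ f : (Fin n → E) → ℝ, Measurable f → (∀ z, |f z| ≤ 1) → ∀ i : ℕ,
          (∫ ω, |((i : ℝ) + 1)⁻¹ * (∑ k ∈ Finset.range (i + 1), f (X n k ω)) -
              ∫ z, f z ∂(tgt dx γ Z n)| ^ p ∂μ) ^ (1 / p) ≤
            C1 n * C2 p / ((i : ℝ) + 1) ^ ((1 : ℝ) / 2) := by
  have hM : IsModel dx P γ Z q1 q B :=
    ⟨hγ, hγfin, hZ, hZ0, hZt, hq1, hq1pos, hq1fin, hq1dens, hq, hqpos, hqfin, hqdens, hBt, hA11,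
      hA1, hδ⟩
  have key : ∀ n, ∃ c : ℝ, 1 ≤ n → n ≤ P → AverageBound dx P γ Z q1 q n c := fun n => by
    by_cases h : 1 ≤ n ∧ n ≤ P
    · obtain ⟨c, -, hc⟩ := hM.exists_averageBound h.1 h.2
      exact ⟨c, fun _ _ => hc⟩
    · exact ⟨0, fun h1 h2 => absurd ⟨h1, h2⟩ h⟩
  choose C1 hC1 using key
  refine ⟨C1, id, fun n h1 hn p hp Ω _ μ _ X x0 hX hx0 hX0 hk1 hkM f hf hf1 i => ?_⟩
  rw [← Real.sqrt_eq_rpow]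
  exact hC1 n h1 hn p hp Ω μ X x0 ⟨hX, hx0, hX0, hk1, hkM⟩ f hf hf1 i

end

end Paper
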